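/- arXiv:1807.03992 — 4 statements merged into one kernel-verified Lean document; each statement's English description precedes it below -/
import Mathlib

section
/- There exists a nonzero homogeneous polynomial G ∈ ℝ[x₀,x₁,x₂,x₃] of degree 3 whose image in ℂ[x₀,x₁,x₂,x₃]/(x₀²+x₁²+x₂²−x₃²) is a squarefree element, such that the set ℝC = {[x] ∈ ℙ³(ℝ) : x₀²+x₁²+x₂² = x₃² and G(x) = 0} is finite with exactly 5 points (a finite real curve of bidegree (3,3) on the quadric ellipsoid with 5 real points). -/
open MvPolynomial

/-- The quadric `x₀² + x₁² + x₂² − x₃²` over `ℂ`. -/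
noncomputable def Qc : MvPolynomial (Fin 4) ℂ :=
  X 0 ^ 2 + X 1 ^ 2 + X 2 ^ 2 - X 3 ^ 2

/-- The image of `G` in the coordinate ring `ℂ[x₀,…,x₃]/(Q)` of the quadric ellipsoid
is a squarefree element. -/
noncomputable def SquarefreeOnEllipsoid (G : MvPolynomial (Fin 4) ℝ) : Prop :=
  Squarefree (Ideal.Quotient.mk (Ideal.span {Qc})
    (MvPolynomial.map (algebraMap ℝ ℂ) G))

/-- The real point set of the curve cut out on the quadric ellipsoid by `G`:
points of `ℙ³(ℝ)` lying on the sphere `x₀² + x₁² + x₂² = x₃²` at which `G` vanishes. -/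
noncomputable def sphereRZ (G : MvPolynomial (Fin 4) ℝ) :
    Set (Projectivization ℝ (Fin 4 → ℝ)) :=
  {x | x.rep 0 ^ 2 + x.rep 1 ^ 2 + x.rep 2 ^ 2 = x.rep 3 ^ 2 ∧
    MvPolynomial.eval x.rep G = 0}

namespace Stmt12

/-- The three-variable polynomial ring over `ℂ`. -/
abbrev B : Type := MvPolynomial (Fin 3) ℂ

/-- `X² + Y² + Z²`. -/
noncomputable def nq : B := X 0 ^ 2 + X 1 ^ 2 + X 2 ^ 2

/-- The quadratic algebra `B[T]/(T² = X²+Y²+Z²)`. -/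
abbrev QA : Type := QuadraticAlgebra B nq 0

/-- The coordinate ring of the quadric cone. -/
abbrev A : Type := MvPolynomial (Fin 4) ℂ ⧸ Ideal.span {Qc}

noncomputable def iota : B →+* A :=
  (Ideal.Quotient.mk (Ideal.span {Qc})).comp
    (MvPolynomial.rename (Fin.castSucc : Fin 3 → Fin 4)).toRingHom

noncomputable instance algBA : Algebra B A := iota.toAlgebra

noncomputable def psi0 : MvPolynomial (Fin 4) ℂ →+* QA :=
  MvPolynomial.eval₂Hom ((algebraMap B QA).comp MvPolynomial.C)
    ![algebraMap B QA (X 0), algebraMap B QA (X 1), algebraMap B QA (X 2), QuadraticAlgebra.omega]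

theorem psi0_C (c : ℂ) : psi0 (C c) = algebraMap B QA (C c) := by simp [psi0]
theorem psi0_X0 : psi0 (X 0) = algebraMap B QA (X 0) := by simp [psi0]
theorem psi0_X1 : psi0 (X 1) = algebraMap B QA (X 1) := by simp [psi0]
theorem psi0_X2 : psi0 (X 2) = algebraMap B QA (X 2) := by simp [psi0]
theorem psi0_X3 : psi0 (X 3) = QuadraticAlgebra.omega := by simp [psi0]

theorem psi0_Qc : psi0 Qc = 0 := by
  rw [Qc, map_sub, map_add, map_add, map_pow, map_pow, map_pow, map_pow,
    psi0_X0, psi0_X1, psi0_X2, psi0_X3, pow_two QuadraticAlgebra.omega,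
    QuadraticAlgebra.omega_mul_omega_eq_mk]
  apply QuadraticAlgebra.ext
  · simp [pow_two]
    simp [nq, pow_two]
  · simp [pow_two]

noncomputable def psi : A →+* QA :=
  Ideal.Quotient.lift (Ideal.span {Qc}) psi0 (by
    intro a ha
    obtain ⟨b, rfl⟩ := Ideal.mem_span_singleton.1 ha
    rw [map_mul, psi0_Qc, zero_mul])

theorem psi_mk (g : MvPolynomial (Fin 4) ℂ) :
    psi (Ideal.Quotient.mk (Ideal.span {Qc}) g) = psi0 g := by
  simp [psi]

theorem algBA_apply (b : B) : algebraMap B A b =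
    Ideal.Quotient.mk (Ideal.span {Qc}) (MvPolynomial.rename Fin.castSucc b) := rfl

noncomputable def chiGen {D : Type*} [CommRing D] [Algebra B D] (u : D)
    (hu : u * u = algebraMap B D nq) : QA →ₐ[B] D :=
  QuadraticAlgebra.lift ⟨u, by rw [zero_smul, add_zero, Algebra.smul_def, mul_one, hu]⟩

theorem chiGen_omega {D : Type*} [CommRing D] [Algebra B D] (u : D)
    (hu : u * u = algebraMap B D nq) : chiGen u hu QuadraticAlgebra.omega = u := by
  simp [chiGen]

theorem mk_X3_sq : Ideal.Quotient.mk (Ideal.span {Qc}) (X 3) *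
    Ideal.Quotient.mk (Ideal.span {Qc}) (X 3) = algebraMap B A nq := by
  rw [algBA_apply, ← map_mul]
  rw [Ideal.Quotient.eq, Ideal.mem_span_singleton]
  refine ⟨-1, ?_⟩
  simp only [nq, Qc, map_add, map_pow, rename_X]
  simp only [show (Fin.castSucc (0 : Fin 3)) = 0 from rfl,
    show (Fin.castSucc (1 : Fin 3)) = 1 from rfl, show (Fin.castSucc (2 : Fin 3)) = 2 from rfl]
  ring

noncomputable def chi : QA →ₐ[B] A := chiGen _ mk_X3_sq

theorem chi_omega : chi QuadraticAlgebra.omega = Ideal.Quotient.mk (Ideal.span {Qc}) (X 3) :=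
  chiGen_omega _ _

theorem chi_psi0 : (chi : QA →+* A).comp psi0 = Ideal.Quotient.mk (Ideal.span {Qc}) := by
  apply MvPolynomial.ringHom_ext
  · intro c
    simp only [RingHom.comp_apply, psi0_C, RingHom.coe_coe, AlgHom.commutes, algBA_apply, rename_C]
  · intro i
    fin_cases i
    · change chi (psi0 (X 0)) = _
      rw [psi0_X0, AlgHom.commutes, algBA_apply, rename_X]; rfl
    · change chi (psi0 (X 1)) = _
      rw [psi0_X1, AlgHom.commutes, algBA_apply, rename_X]; rfl
    · change chi (psi0 (X 2)) = _
      rw [psi0_X2, AlgHom.commutes, algBA_apply, rename_X]; rfl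
    · change chi (psi0 (X 3)) = _
      rw [psi0_X3, chi_omega]; rfl

theorem chi_psi (a : A) : chi (psi a) = a := by
  obtain ⟨g, rfl⟩ := Ideal.Quotient.mk_surjective a
  rw [psi_mk]
  exact RingHom.congr_fun chi_psi0 g

theorem isUnit_of_norm {a : A} (h : IsUnit (QuadraticAlgebra.norm (psi a))) : IsUnit a := by
  have h1 : IsUnit (psi a) := QuadraticAlgebra.isUnit_iff_norm_isUnit.2 h
  have h2 := h1.map chi
  rwa [chi_psi] at h2

/-- The cubic. -/
noncomputable def cubic (K : Type*) [CommRing K] : MvPolynomial (Fin 4) K :=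
  X 3 * (X 0 ^ 2 + X 1 ^ 2) - (X 0 ^ 3 - (X 0 * X 1 ^ 2 + X 0 * X 1 ^ 2 + X 0 * X 1 ^ 2))

noncomputable def S : B := 3 * X 0 ^ 2 * X 1 - X 1 ^ 3
noncomputable def R : B := X 0 ^ 2 + X 1 ^ 2

theorem norm_cubic : QuadraticAlgebra.norm (psi0 (cubic ℂ)) = -(S ^ 2 + R ^ 2 * X 2 ^ 2) := by
  have : psi0 (cubic ℂ) = ⟨-(X 0 ^ 3 - 3 * X 0 * X 1 ^ 2), R⟩ := by
    simp only [cubic, map_sub, map_mul, map_add, map_pow, psi0_X0, psi0_X1, psi0_X3]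
    apply QuadraticAlgebra.ext
    · simp [pow_succ]; ring
    · simp [R, pow_succ]
  rw [this, QuadraticAlgebra.norm_def]
  simp only [S, R, nq]
  ring

theorem not_dvd_of_eval (p q : B) (v : Fin 3 → ℂ) (hp : eval v p = 0) (hq : eval v q ≠ 0) :
    ¬ p ∣ q := by
  rintro ⟨k, rfl⟩
  simp [hp] at hq

theorem no_prime (p : B) (hp : Prime p) (h1 : p ∣ S) (h2 : p ∣ R ∨ p ∣ X 2) : False := by
  rcases h2 with h2 | h2
  · have h4 : p ∣ 4 * X 1 ^ 3 := by
      have : (4 * X 1 ^ 3 : B) = 3 * X 1 * R - S := by simp only [R, S]; ring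
      rw [this]
      exact dvd_sub (h2.mul_left _) h1
    have h5 : p ∣ X 1 ^ 3 := by
      have : (X 1 ^ 3 : B) = C (1/4) * (4 * X 1 ^ 3) := by
        rw [show (4 : B) = C 4 from rfl, ← mul_assoc, ← C_mul]; norm_num
      rw [this]; exact h4.mul_left _
    have hY : p ∣ X 1 := hp.dvd_of_dvd_pow h5
    have hX : p ∣ X 0 := by
      apply hp.dvd_of_dvd_pow (n := 2)
      have : (X 0 ^ 2 : B) = R - X 1 * X 1 := by simp only [R]; ring
      rw [this]
      exact dvd_sub h2 (hY.mul_right _)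
    have hass := hp.irreducible.associated_of_dvd (X_prime (i := (1 : Fin 3))).irreducible hY
    exact not_dvd_of_eval (X 1) (X 0) ![1, 0, 0] (by simp) (by simp) (hass.symm.dvd.trans hX)
  · have hass := hp.irreducible.associated_of_dvd (X_prime (i := (2 : Fin 3))).irreducible h2
    exact not_dvd_of_eval (X 2) S ![1, 1, 0] (by simp) (by simp [S]; norm_num)
      (hass.symm.dvd.trans h1)

theorem sqfree_norm (d : B) (h : d * d ∣ S ^ 2 + R ^ 2 * X 2 ^ 2) : IsUnit d := by
  by_contra hu
  have hF : (S ^ 2 + R ^ 2 * X 2 ^ 2 : B) ≠ 0 := by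
    intro h0
    have := congrArg (eval ![1, 1, 0]) h0
    simp [S, R] at this
    norm_num at this
  have hd0 : d ≠ 0 := by
    rintro rfl
    rw [zero_mul] at h
    exact hF (zero_dvd_iff.1 h)
  obtain ⟨p, hpi, hpd⟩ := WfDvdMonoid.exists_irreducible_factor hu hd0
  have hp := hpi.prime
  have hpF : p ∣ S ^ 2 + R ^ 2 * X 2 ^ 2 := hpd.trans ((dvd_mul_right d d).trans h)
  have hpD : p ∣ pderiv 2 (S ^ 2 + R ^ 2 * X 2 ^ 2) := by
    obtain ⟨k, hk⟩ := h
    rw [hk]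
    refine hpd.trans ?_
    rw [mul_assoc, Derivation.leibniz]
    simp only [smul_eq_mul, Derivation.leibniz]
    exact ⟨d * pderiv 2 k + k * pderiv 2 d + k * pderiv 2 d, by ring⟩
  have hD : pderiv 2 (S ^ 2 + R ^ 2 * X 2 ^ 2) = 2 * (R ^ 2 * X 2) := by
    have h20 : pderiv (2 : Fin 3) (X 0 : B) = 0 := pderiv_X_of_ne (by decide)
    have h21 : pderiv (2 : Fin 3) (X 1 : B) = 0 := pderiv_X_of_ne (by decide)
    have h3 : pderiv (2 : Fin 3) (3 : B) = 0 := pderiv_C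
    have hS : pderiv (2 : Fin 3) S = 0 := by
      simp [S, Derivation.leibniz, Derivation.leibniz_pow, h20, h21, h3]
    have hR : pderiv (2 : Fin 3) R = 0 := by
      simp [R, Derivation.leibniz_pow, h20, h21]
    simp [Derivation.leibniz, Derivation.leibniz_pow, hS, hR]
    ring
  rw [hD] at hpD
  have hRZ : p ∣ R ^ 2 * X 2 := by
    have : (R ^ 2 * X 2 : B) = C (1/2) * (2 * (R ^ 2 * X 2)) := by
      rw [show (2 : B) = C 2 from rfl, ← mul_assoc (C (1/2)), ← C_mul]; norm_num
    rw [this]; exact hpD.mul_left _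
  have hS : p ∣ S := by
    apply hp.dvd_of_dvd_pow (n := 2)
    have : (S ^ 2 : B) = (S ^ 2 + R ^ 2 * X 2 ^ 2) - (R ^ 2 * X 2) * X 2 := by ring
    rw [this]
    exact dvd_sub hpF (hRZ.mul_right _)
  refine no_prime p hp hS ?_
  rcases hp.dvd_or_dvd hRZ with h' | h'
  · exact Or.inl (hp.dvd_of_dvd_pow h')
  · exact Or.inr h'

theorem sqfree : SquarefreeOnEllipsoid (cubic ℝ) := by
  have hm : MvPolynomial.map (algebraMap ℝ ℂ) (cubic ℝ) = cubic ℂ := by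
    simp [cubic]
  rw [SquarefreeOnEllipsoid, hm]
  intro a ha
  apply isUnit_of_norm
  apply sqfree_norm
  obtain ⟨k, hk⟩ := ha
  have := congrArg (fun x => QuadraticAlgebra.norm (psi x)) hk
  simp only [psi_mk, norm_cubic, map_mul] at this
  rw [← dvd_neg, this]
  exact dvd_mul_right _ _

theorem eval_cubic (v : Fin 4 → ℝ) : eval v (cubic ℝ) =
    v 3 * (v 0 ^ 2 + v 1 ^ 2) - (v 0 ^ 3 - 3 * v 0 * v 1 ^ 2) := by
  simp [cubic]; ring

theorem cubic_ne : cubic ℝ ≠ 0 := by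
  intro h
  have := congrArg (eval ![0, 1, 0, 1]) h
  rw [eval_cubic] at this
  simp at this

theorem cubic_hom : (cubic ℝ).IsHomogeneous 3 := by
  have hX : ∀ i : Fin 4, (X i : MvPolynomial (Fin 4) ℝ).IsHomogeneous 1 :=
    fun i => isHomogeneous_X _ i
  have h2 : ∀ i : Fin 4, (X i ^ 2 : MvPolynomial (Fin 4) ℝ).IsHomogeneous 2 :=
    fun i => (hX i).pow 2
  have h3 : (X 0 ^ 3 : MvPolynomial (Fin 4) ℝ).IsHomogeneous 3 := (hX 0).pow 3
  have h12 : (X 0 * X 1 ^ 2 : MvPolynomial (Fin 4) ℝ).IsHomogeneous 3 := (hX 0).mul (h2 1)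
  exact ((hX 3).mul ((h2 0).add (h2 1))).sub (h3.sub ((h12.add h12).add h12))

/-- The five real points. -/
noncomputable def pts : Fin 5 → (Fin 4 → ℝ) :=
  ![![0, 0, 1, 1], ![0, 0, -1, 1], ![1, 0, 0, 1], ![-1, Real.sqrt 3, 0, 2],
    ![-1, -Real.sqrt 3, 0, 2]]

theorem pts_ne (i : Fin 5) : pts i ≠ 0 := by
  intro h
  have := congrFun h 3
  fin_cases i <;> simp [pts] at this

noncomputable def P (i : Fin 5) : Projectivization ℝ (Fin 4 → ℝ) :=
  Projectivization.mk ℝ (pts i) (pts_ne i)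

theorem P_inj : Function.Injective P := by
  intro i j h
  obtain ⟨a, ha⟩ := (Projectivization.mk_eq_mk_iff' ℝ _ _ _ _).1 h
  have h0 := congrFun ha 0
  have h1 := congrFun ha 1
  have h2 := congrFun ha 2
  have h3 := congrFun ha 3
  have hs : Real.sqrt 3 > 0 := by positivity
  fin_cases i <;> fin_cases j <;> first | rfl | (exfalso; simp [pts] at h0 h1 h2 h3; try nlinarith)

theorem P_mem (i : Fin 5) : P i ∈ sphereRZ (cubic ℝ) := by
  obtain ⟨a, ha⟩ := Projectivization.exists_smul_eq_mk_rep ℝ (pts i) (pts_ne i)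
  have hs : Real.sqrt 3 ^ 2 = 3 := Real.sq_sqrt (by norm_num)
  have hv : (P i).rep = fun k => (a : ℝ) * pts i k := by
    rw [P, ← ha]; rfl
  rw [sphereRZ, Set.mem_ofPred_eq, eval_cubic, hv]
  fin_cases i <;> simp [pts, mul_pow, hs] <;> (try constructor) <;> ring

theorem mem_P (x : Projectivization ℝ (Fin 4 → ℝ)) (hx : x ∈ sphereRZ (cubic ℝ)) :
    ∃ i, P i = x := by
  have key : ∀ i (c : ℝ), (c * pts i 0 = x.rep 0 ∧ c * pts i 1 = x.rep 1 ∧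
      c * pts i 2 = x.rep 2 ∧ c * pts i 3 = x.rep 3) → P i = x := by
    intro i c h'
    have h : ∀ k, c * pts i k = x.rep k := by
      intro k
      fin_cases k
      exacts [h'.1, h'.2.1, h'.2.2.1, h'.2.2.2]
    rw [← x.mk_rep]
    symm
    exact (Projectivization.mk_eq_mk_iff' ℝ _ _ _ _).2 ⟨c, funext h⟩
  rw [sphereRZ, Set.mem_ofPred_eq, eval_cubic] at hx
  obtain ⟨h1, h2⟩ := hx
  have hs : Real.sqrt 3 ^ 2 = 3 := Real.sq_sqrt (by norm_num)
  generalize x.rep = v at *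
  obtain ⟨p, hp⟩ : ∃ p, p = v 0 := ⟨_, rfl⟩
  obtain ⟨q, hq⟩ : ∃ q, q = v 1 := ⟨_, rfl⟩
  obtain ⟨r, hr⟩ : ∃ r, r = v 2 := ⟨_, rfl⟩
  obtain ⟨t, ht⟩ : ∃ t, t = v 3 := ⟨_, rfl⟩
  simp only [← hp, ← hq, ← hr, ← ht] at key h1 h2
  have h3 : (t * (p ^ 2 + q ^ 2)) ^ 2 = (p ^ 3 - 3 * p * q ^ 2) ^ 2 := by
    rw [show t * (p ^ 2 + q ^ 2) = p ^ 3 - 3 * p * q ^ 2 by linarith]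
  have h4 : (3 * p ^ 2 * q - q ^ 3) ^ 2 + ((p ^ 2 + q ^ 2) * r) ^ 2 = 0 := by
    linear_combination h3 + (p ^ 2 + q ^ 2) ^ 2 * h1
  have hS : q * (3 * p ^ 2 - q ^ 2) = 0 := by
    have : 3 * p ^ 2 * q - q ^ 3 = 0 := by
      apply pow_eq_zero_iff (two_ne_zero) |>.1
      nlinarith [sq_nonneg (3 * p ^ 2 * q - q ^ 3), sq_nonneg ((p ^ 2 + q ^ 2) * r)]
    linarith
  have hR : (p ^ 2 + q ^ 2) * r = 0 := by
    apply pow_eq_zero_iff (two_ne_zero) |>.1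
    nlinarith [sq_nonneg (3 * p ^ 2 * q - q ^ 3), sq_nonneg ((p ^ 2 + q ^ 2) * r)]
  by_cases hpq : p ^ 2 + q ^ 2 = 0
  · have hp0 : p = 0 := by nlinarith
    have hq0 : q = 0 := by nlinarith
    have : (r - t) * (r + t) = 0 := by rw [hp0, hq0] at h1; linarith
    rcases mul_eq_zero.1 this with h | h
    · refine ⟨0, key 0 t ?_⟩
      simp [pts]
      exact ⟨hp0.symm, hq0.symm, by linarith⟩
    · refine ⟨1, key 1 t ?_⟩
      simp [pts]
      exact ⟨hp0.symm, hq0.symm, by linarith⟩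
  · have hr0 : r = 0 := (mul_eq_zero.1 hR).resolve_left hpq
    rcases mul_eq_zero.1 hS with h | h
    · subst h
      have hp0 : p ^ 2 ≠ 0 := by simpa using hpq
      have : t = p := mul_right_cancel₀ hp0 (by linarith)
      refine ⟨2, key 2 p ?_⟩
      simp [pts]
      exact ⟨hr0.symm, this.symm⟩
    · have hq2 : q ^ 2 = 3 * p ^ 2 := by linarith
      rw [hq2] at h2 hpq
      have hp0 : p ^ 2 ≠ 0 := by intro h0; apply hpq; rw [h0]; norm_num
      have : t = -2 * p := mul_right_cancel₀ hp0 (by linarith)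
      have h5 : (q - p * Real.sqrt 3) * (q + p * Real.sqrt 3) = 0 := by
        linear_combination hq2 - p ^ 2 * hs
      rcases mul_eq_zero.1 h5 with h | h
      · refine ⟨4, key 4 (-p) ?_⟩
        simp [pts]
        exact ⟨by linarith, hr0.symm, by linarith⟩
      · refine ⟨3, key 3 (-p) ?_⟩
        simp [pts]
        exact ⟨by linarith, hr0.symm, by linarith⟩

end Stmt12

open Stmt12 in
theorem stmt_12 :
    ∃ G : MvPolynomial (Fin 4) ℝ, G ≠ 0 ∧ G.IsHomogeneous 3 ∧
      SquarefreeOnEllipsoid G ∧ (sphereRZ G).Finite ∧ (sphereRZ G).ncard = 5 := by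
  have hr : sphereRZ (cubic ℝ) = Set.range P := by
    ext x
    exact ⟨mem_P x, by rintro ⟨i, rfl⟩; exact P_mem i⟩
  refine ⟨cubic ℝ, cubic_ne, cubic_hom, sqfree, ?_, ?_⟩
  · rw [hr]; exact Set.finite_range P
  · rw [hr, ← Set.image_univ, Set.ncard_image_of_injective _ P_inj, Set.ncard_univ]
    simp
end

section
/- There exists a nonzero homogeneous polynomial G ∈ ℝ[x₀,x₁,x₂,x₃] of degree 4 whose image in ℂ[x₀,x₁,x₂,x₃]/(x₀²+x₁²+x₂²−x₃²) is a squarefree element, such that the set ℝC = {[x] ∈ ℙ³(ℝ) : x₀²+x₁²+x₂² = x₃² and G(x) = 0} is finite with exactly 10 points (a finite real curve of bidegree (4,4) on the quadric ellipsoid with 10 real points). -/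
open MvPolynomial

/-- The quartic: with `u = x₃ - x₂`, `v = x₃ + x₂`, `ζ = x₀ + i x₁`,
`G = v²(v-7u)² + 36u³v + 12(v-7u) Re ζ³`. -/
noncomputable def Gq (K : Type) [Field K] : MvPolynomial (Fin 4) K :=
  (X 3 + X 2) ^ 2 * ((X 3 + X 2) - C 7 * (X 3 - X 2)) ^ 2
    + C 36 * ((X 3 - X 2) ^ 3 * (X 3 + X 2))
    + C 12 * (((X 3 + X 2) - C 7 * (X 3 - X 2)) * (X 0 ^ 3 - C 3 * (X 0 * X 1 ^ 2)))

lemma Gq_hom (K : Type) [Field K] : (Gq K).IsHomogeneous 4 := by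
  have hX : ∀ i, (X i : MvPolynomial (Fin 4) K).IsHomogeneous 1 := fun i => isHomogeneous_X _ _
  have hC : ∀ (c : K) (p : MvPolynomial (Fin 4) K) (n : ℕ), p.IsHomogeneous n →
      (C c * p).IsHomogeneous n := by
    intro c p n h
    simpa using (isHomogeneous_C (Fin 4) c).mul h
  have hu := (hX 3).sub (hX 2)
  have hv := (hX 3).add (hX 2)
  have hw := hv.sub (hC 7 _ _ hu)
  have h1 := (hv.pow 2).mul (hw.pow 2)
  have h2 := hC 36 _ _ ((hu.pow 3).mul hv)
  have h3 := hC 3 _ _ ((hX 0).mul ((hX 1).pow 2))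
  have h4 := hC 12 _ _ (hw.mul (((hX 0).pow 3).sub h3))
  exact (h1.add h2).add h4

lemma irr_aux (a b c d : Fin 4) (hab : a ≠ b) (hac : a ≠ c) (had : a ≠ d) (hbc : b ≠ c)
    (hbd : b ≠ d) (hcd : c ≠ d) :
    Irreducible ((X c ^ 3 + C 6 * X d ^ 3) * X a + C (-7) * (X b * (X d * X c ^ 2)) :
      MvPolynomial (Fin 4) ℂ) := by
  have hirr : ∀ i, Irreducible (X i : MvPolynomial (Fin 4) ℂ) := fun i =>
    (MvPolynomial.X_prime (i := i)).irreducible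
  have key : ∀ (i : Fin 4) (e : Fin 4 → ℂ), e i = 0 → e c ^ 3 + 6 * e d ^ 3 ≠ 0 →
      IsRelPrime (X c ^ 3 + C 6 * X d ^ 3 : MvPolynomial (Fin 4) ℂ) (X i) := by
    intro i e h0 h1
    refine IsRelPrime.symm ((hirr i).isRelPrime_iff_not_dvd.2 ?_)
    rintro ⟨k, hk⟩
    have := congrArg (MvPolynomial.eval e) hk
    simp [h0] at this
    exact h1 this
  apply irreducible_mul_X_add
  · intro h
    have := congrArg (MvPolynomial.eval (fun _ => (1 : ℂ))) h
    norm_num at this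
  · intro h
    have h1 := vars_add_subset _ _ h
    rw [Finset.mem_union] at h1
    rcases h1 with h1 | h1
    · have := vars_pow _ _ h1
      simp [hac] at this
    · rw [vars_C_mul _ (by norm_num)] at h1
      have := vars_pow _ _ h1
      simp [had] at this
  · intro h
    rw [vars_C_mul _ (by norm_num)] at h
    have h1 := vars_mul _ _ h
    rw [Finset.mem_union] at h1
    rcases h1 with h1 | h1
    · simp [hab] at h1
    · have h2 := vars_mul _ _ h1
      rw [Finset.mem_union] at h2
      rcases h2 with h2 | h2
      · simp [had] at h2
      · have := vars_pow _ _ h2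
        simp [hac] at this
  · have hb := key b (Function.update (fun _ => 1) b 0) (by simp)
      (by simp [Function.update_of_ne hbc.symm, Function.update_of_ne hbd.symm]; norm_num)
    have hc := key c (Function.update (fun _ => 1) c 0) (by simp)
      (by simp [Function.update_of_ne hcd.symm])
    have hd := key d (Function.update (fun _ => 1) d 0) (by simp)
      (by simp [Function.update_of_ne hcd])
    have hu : IsUnit (C (-7) : MvPolynomial (Fin 4) ℂ) :=
      (isUnit_iff_ne_zero.2 (by norm_num : (-7 : ℂ) ≠ 0)).map C
    refine IsRelPrime.mul_right (hu.isRelPrime_right) (hb.mul_right (hd.mul_right ?_))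
    exact hc.pow_right

/-- `s = X 0`, `t = X 1`, `p = X 2`, `q = X 3`. -/
noncomputable def F1 : MvPolynomial (Fin 4) ℂ :=
  (X 3 ^ 3 + C 6 * X 2 ^ 3) * X 1 + C (-7) * (X 0 * (X 2 * X 3 ^ 2))

noncomputable def F2 : MvPolynomial (Fin 4) ℂ :=
  (X 1 ^ 3 + C 6 * X 0 ^ 3) * X 3 + C (-7) * (X 2 * (X 0 * X 1 ^ 2))

lemma F_sqf : Squarefree (F1 * F2) := by
  have h1 : Irreducible F1 := irr_aux 1 0 3 2 (by decide) (by decide) (by decide) (by decide)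
    (by decide) (by decide)
  have h2 : Irreducible F2 := irr_aux 3 2 1 0 (by decide) (by decide) (by decide) (by decide)
    (by decide) (by decide)
  refine squarefree_mul_iff.2 ⟨h1.isRelPrime_iff_not_dvd.2 ?_, h1.squarefree, h2.squarefree⟩
  rintro ⟨k, hk⟩
  have := congrArg (MvPolynomial.eval ![(1 : ℂ), 0, 0, 1]) hk
  simp [F1, F2] at this

/-- The Segre parametrisation. -/
noncomputable def seg : MvPolynomial (Fin 4) ℂ →ₐ[ℂ] MvPolynomial (Fin 4) ℂ :=
  aeval ![C (1 / 2) * (X 0 * X 3 + X 1 * X 2),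
    C (-Complex.I / 2) * (X 0 * X 3 - X 1 * X 2),
    C (1 / 2) * (X 1 * X 3 - X 0 * X 2),
    C (1 / 2) * (X 1 * X 3 + X 0 * X 2)]

lemma eval_seg (e : Fin 4 → ℂ) (P : MvPolynomial (Fin 4) ℂ) :
    MvPolynomial.eval e (seg P) = MvPolynomial.eval
      ![1 / 2 * (e 0 * e 3 + e 1 * e 2), -Complex.I / 2 * (e 0 * e 3 - e 1 * e 2),
        1 / 2 * (e 1 * e 3 - e 0 * e 2), 1 / 2 * (e 1 * e 3 + e 0 * e 2)] P := by
  rw [seg, ← MvPolynomial.coe_aeval_eq_eval, RingHom.coe_coe, ← AlgHom.comp_apply, comp_aeval,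
    ← MvPolynomial.coe_aeval_eq_eval, RingHom.coe_coe]
  congr 2
  funext i
  fin_cases i <;> simp

lemma seg_Q : seg Qc = 0 := by
  apply MvPolynomial.funext
  intro e
  rw [eval_seg]
  simp only [Qc, map_add, map_sub, map_pow, eval_X, map_zero, Matrix.cons_val]
  linear_combination (e 0 * e 3 - e 1 * e 2) ^ 2 / 4 * Complex.I_sq

lemma seg_G : seg (Gq ℂ) = F1 * F2 := by
  apply MvPolynomial.funext
  intro e
  rw [eval_seg]
  simp only [Gq, F1, F2, map_add, map_sub, map_mul, map_pow, eval_X, eval_C, Matrix.cons_val]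
  have hI : (-Complex.I / 2 * (e 0 * e 3 - e 1 * e 2)) ^ 2
      = - (e 0 * e 3 - e 1 * e 2) ^ 2 / 4 := by
    linear_combination (e 0 * e 3 - e 1 * e 2) ^ 2 / 4 * Complex.I_sq
  rw [hI]
  ring

lemma exists_param (u v z w : ℂ) (h : u * v = z * w) :
    ∃ s t p q : ℂ, u = s * p ∧ v = t * q ∧ z = s * q ∧ w = t * p := by
  by_cases hu : u = 0
  · subst hu
    rw [zero_mul, eq_comm, mul_eq_zero] at h
    rcases h with rfl | rfl
    · exact ⟨0, 1, w, v, by simp⟩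
    · exact ⟨z, v, 0, 1, by simp⟩
  · refine ⟨1, w / u, u, z, by simp, ?_, by simp, by field_simp⟩
    field_simp
    linear_combination h

lemma ker_seg (P : MvPolynomial (Fin 4) ℂ) (h : seg P = 0) :
    P ∈ (Ideal.span {Qc}).radical := by
  rw [← vanishingIdeal_zeroLocus_eq_radical (K := ℂ), mem_vanishingIdeal_iff]
  intro x hx
  have hQ := hx Qc (Ideal.mem_span_singleton_self _)
  simp only [Qc, map_add, map_sub, map_pow, aeval_X] at hQ
  obtain ⟨s, t, p, q, h1, h2, h3, h4⟩ := exists_param (x 3 - x 2) (x 3 + x 2)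
    (x 0 + Complex.I * x 1) (x 0 - Complex.I * x 1)
    (by linear_combination -hQ + x 1 ^ 2 * Complex.I_sq)
  have := eval_seg ![s, t, p, q] P
  rw [h, map_zero] at this
  simp only [Matrix.cons_val] at this
  rw [← h1, ← h2, ← h3, ← h4] at this
  rw [← MvPolynomial.coe_aeval_eq_eval, RingHom.coe_coe] at this
  rw [this]
  congr 2
  funext i
  fin_cases i <;> simp only [Fin.mk_zero, Fin.mk_one, Fin.reduceFinMk, Matrix.cons_val]
  · ring
  · linear_combination x 1 * Complex.I_sq
  · ring
  · ring

lemma G_sqf : SquarefreeOnEllipsoid (Gq ℝ) := by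
  have hmap : MvPolynomial.map (algebraMap ℝ ℂ) (Gq ℝ) = Gq ℂ := by
    simp [Gq]
  unfold SquarefreeOnEllipsoid
  rw [hmap]
  rintro x ⟨y, hy⟩
  obtain ⟨P, rfl⟩ := Ideal.Quotient.mk_surjective x
  obtain ⟨Y, rfl⟩ := Ideal.Quotient.mk_surjective y
  rw [← map_mul, ← map_mul, Ideal.Quotient.eq, Ideal.mem_span_singleton] at hy
  obtain ⟨k, hk⟩ := hy
  have h1 := congrArg seg hk
  rw [map_sub, map_mul seg Qc, seg_Q, zero_mul, sub_eq_zero, seg_G, map_mul, map_mul] at h1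
  have hunit := F_sqf (seg P) ⟨_, h1⟩
  obtain ⟨c, hc, hPc⟩ := isUnit_iff_eq_C_of_isReduced.1 hunit
  have h2 : seg (P - C c) = 0 := by
    rw [map_sub, hPc, seg, aeval_C]; simp [algebraMap_eq]
  obtain ⟨n, hn⟩ := ker_seg _ h2
  have hnil : IsNilpotent (Ideal.Quotient.mk (Ideal.span {Qc}) (P - C c)) := by
    refine ⟨n, ?_⟩
    rw [← map_pow]
    exact Ideal.Quotient.eq_zero_iff_mem.2 hn
  have hu : IsUnit (Ideal.Quotient.mk (Ideal.span {Qc}) (C c)) :=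
    (hc.map C).map _
  have := hnil.isUnit_add_left_of_commute hu (Commute.all _ _)
  rwa [← map_add, add_sub_cancel] at this

/-- affine chart -/
noncomputable def chart (z : ℝ × ℝ) : Fin 4 → ℝ :=
  ![z.1, z.2, (z.1 ^ 2 + z.2 ^ 2 - 1) / 2, (z.1 ^ 2 + z.2 ^ 2 + 1) / 2]

lemma chart_ne (z : ℝ × ℝ) : chart z ≠ 0 := by
  intro h
  have := congrFun h 3
  simp [chart] at this
  nlinarith [sq_nonneg z.1, sq_nonneg z.2]

noncomputable def pt (z : ℝ × ℝ) : Projectivization ℝ (Fin 4 → ℝ) := Projectivization.mk ℝ (chart z) (chart_ne z)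

lemma pt_inj : Function.Injective pt := by
  intro z w h
  obtain ⟨a, ha⟩ := (Projectivization.mk_eq_mk_iff' _ _ _ _ _).1 h
  have h0 := congrFun ha 0
  have h1 := congrFun ha 1
  have h2 := congrFun ha 2
  have h3 := congrFun ha 3
  simp [chart] at h0 h1 h2 h3
  have : a = 1 := by linear_combination h3 - h2
  subst this
  ext <;> linarith

lemma eval_G (x : Fin 4 → ℝ) : MvPolynomial.eval x (Gq ℝ) =
    (x 3 + x 2) ^ 2 * ((x 3 + x 2) - 7 * (x 3 - x 2)) ^ 2 + 36 * ((x 3 - x 2) ^ 3 * (x 3 + x 2))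
    + 12 * (((x 3 + x 2) - 7 * (x 3 - x 2)) * (x 0 ^ 3 - 3 * (x 0 * x 1 ^ 2))) := by
  simp [Gq]

/-- The affine zero set. -/
def Z : Set (ℝ × ℝ) := {z | (z.1 ^ 2 + z.2 ^ 2 - 7) * (z.1 ^ 2 - z.2 ^ 2) + 6 * z.1 = 0 ∧
  (z.1 ^ 2 + z.2 ^ 2 - 7) * (2 * z.1 * z.2) - 6 * z.2 = 0}

lemma sphere_eq : sphereRZ (Gq ℝ) = pt '' Z := by
  ext P
  constructor
  · rintro ⟨hS, hG⟩
    have hne := P.rep_nonzero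
    have hmk := P.mk_rep
    set x := P.rep with hx
    rw [eval_G] at hG
    have hu : x 3 - x 2 ≠ 0 := by
      intro hu
      have e : x 3 = x 2 := by linarith
      have h01 : x 0 ^ 2 + x 1 ^ 2 = 0 := by rw [e] at hS; linarith
      have h0 : x 0 = 0 := by nlinarith [sq_nonneg (x 0), sq_nonneg (x 1)]
      have h1 : x 1 = 0 := by nlinarith [sq_nonneg (x 0), sq_nonneg (x 1)]
      rw [h0, h1, e] at hG
      have h2 : x 2 ^ 4 = 0 := by linarith
      have h2 : x 2 = 0 := by simpa using h2
      apply hne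
      funext i
      fin_cases i <;> simp [h0, h1, h2, e]
    set u := x 3 - x 2 with hu'
    have hr : (x 0 / u) ^ 2 + (x 1 / u) ^ 2 = (x 3 + x 2) / u := by
      field_simp
      rw [hu']
      linear_combination hS
    refine ⟨(x 0 / u, x 1 / u), ?_, ?_⟩
    · set a := x 0 / u with ha
      set b := x 1 / u with hb
      have ea : x 0 = a * u := by rw [ha]; field_simp
      have eb : x 1 = b * u := by rw [hb]; field_simp
      have ev : x 3 + x 2 = (a ^ 2 + b ^ 2) * u := by rw [hr]; field_simp
      rw [ev, ea, eb] at hG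
      have key : u ^ 4 * (((a ^ 2 + b ^ 2 - 7) * (a ^ 2 - b ^ 2) + 6 * a) ^ 2 +
        ((a ^ 2 + b ^ 2 - 7) * (2 * a * b) - 6 * b) ^ 2) = 0 := by
        linear_combination hG
      have key := (mul_eq_zero.1 key).resolve_left (pow_ne_zero 4 hu)
      constructor
      · show (a ^ 2 + b ^ 2 - 7) * (a ^ 2 - b ^ 2) + 6 * a = 0
        have := sq_nonneg ((a ^ 2 + b ^ 2 - 7) * (2 * a * b) - 6 * b)
        exact pow_eq_zero_iff two_ne_zero |>.1 (le_antisymm (by linarith) (sq_nonneg _))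
      · show (a ^ 2 + b ^ 2 - 7) * (2 * a * b) - 6 * b = 0
        have := sq_nonneg ((a ^ 2 + b ^ 2 - 7) * (a ^ 2 - b ^ 2) + 6 * a)
        exact pow_eq_zero_iff two_ne_zero |>.1 (le_antisymm (by linarith) (sq_nonneg _))
    · rw [← hmk]
      refine (Projectivization.mk_eq_mk_iff' _ _ _ _ _).2 ⟨u⁻¹, ?_⟩
      funext i
      fin_cases i <;> simp only [chart, hr, Pi.smul_apply, smul_eq_mul, Fin.mk_zero, Fin.mk_one,
        Fin.reduceFinMk, Matrix.cons_val]
      · rw [← hx]; field_simp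
      · rw [← hx]; field_simp
      · field_simp
        rw [hu']; ring
      · field_simp
        rw [hu']; ring
  · rintro ⟨z, ⟨h1, h2⟩, rfl⟩
    obtain ⟨a, ha⟩ := Projectivization.exists_smul_eq_mk_rep ℝ (chart z) (chart_ne z)
    show (pt z).rep 0 ^ 2 + (pt z).rep 1 ^ 2 + (pt z).rep 2 ^ 2 = (pt z).rep 3 ^ 2 ∧
      MvPolynomial.eval (pt z).rep (Gq ℝ) = 0
    rw [eval_G, pt, ← ha]
    simp only [chart, Pi.smul_apply, Units.smul_def, smul_eq_mul, Matrix.cons_val]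
    constructor
    · ring
    · linear_combination (a : ℝ) ^ 4 * ((z.1 ^ 2 + z.2 ^ 2 - 7) * (z.1 ^ 2 - z.2 ^ 2) + 6 * z.1) * h1
        + (a : ℝ) ^ 4 * ((z.1 ^ 2 + z.2 ^ 2 - 7) * (2 * z.1 * z.2) - 6 * z.2) * h2

/-- The ten affine zeros, written as `t ω ^ k`. -/
noncomputable def zlist : List (ℝ × ℝ) :=
  [(0, 0), (1, 0), (2, 0), (-3, 0), (-1/2, √3 * (1/2)), (-1/2, √3 * (-1/2)), (-1, √3 * 1),
    (-1, √3 * (-1)), (3/2, √3 * (3/2)), (3/2, √3 * (-3/2))]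

lemma cubic {t : ℝ} (h : t ^ 3 - 7 * t + 6 = 0) : t = 1 ∨ t = 2 ∨ t = -3 := by
  have : (t - 1) * ((t - 2) * (t + 3)) = 0 := by linear_combination h
  rcases mul_eq_zero.1 this with h | h
  · left; linarith
  rcases mul_eq_zero.1 h with h | h
  · right; left; linarith
  · right; right; linarith

lemma Z_eq : Z = {z | z ∈ zlist} := by
  have h3 : √3 ^ 2 = (3 : ℝ) := Real.sq_sqrt (by norm_num)
  ext ⟨x, y⟩
  constructor
  · rintro ⟨h1, h2⟩
    simp only at h1 h2
    by_cases hy : y = 0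
    · subst hy
      have : x * (x ^ 3 - 7 * x + 6) = 0 := by linear_combination h1
      rcases mul_eq_zero.1 this with h | h
      · simp [zlist, h]
      · rcases cubic h with h | h | h <;> simp [zlist, h]
    · have e : (x ^ 2 + y ^ 2 - 7) * x = 3 := by
        have : y * ((x ^ 2 + y ^ 2 - 7) * x - 3) = 0 := by linear_combination h2 / 2
        have := (mul_eq_zero.1 this).resolve_left hy
        linarith
      have e2 : y ^ 2 = 3 * x ^ 2 := by
        linear_combination (-1 / 3) * x * h1 + (1 / 3) * (x ^ 2 - y ^ 2) * e
      have e3 : (-2 * x) ^ 3 - 7 * (-2 * x) + 6 = 0 := by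
        rw [e2] at e
        linear_combination (-2) * e
      have e4 : (y - √3 * x) * (y - √3 * (-x)) = 0 := by
        linear_combination e2 - x ^ 2 * h3
      have hx : x = -1/2 ∨ x = -1 ∨ x = 3/2 := by
        rcases cubic e3 with h | h | h
        · left; linarith
        · right; left; linarith
        · right; right; linarith
      have hy' : y = √3 * x ∨ y = √3 * (-x) := by
        rcases mul_eq_zero.1 e4 with h | h
        · left; linarith
        · right; linarith
      rcases hx with rfl | rfl | rfl <;> rcases hy' with rfl | rfl <;>
        norm_num [zlist]
  · intro h
    simp only [zlist, Set.mem_ofPred_eq, List.mem_cons, Prod.mk.injEq, List.not_mem_nil, or_false] at h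
    rcases h with ⟨rfl, rfl⟩ | ⟨rfl, rfl⟩ | ⟨rfl, rfl⟩ | ⟨rfl, rfl⟩ | ⟨rfl, rfl⟩ | ⟨rfl, rfl⟩ |
      ⟨rfl, rfl⟩ | ⟨rfl, rfl⟩ | ⟨rfl, rfl⟩ | ⟨rfl, rfl⟩ <;>
    constructor <;> simp only [mul_pow, h3] <;> ring

lemma zlist_nodup : zlist.Nodup := by
  have h3 : √3 ≠ 0 := by positivity
  simp only [zlist, List.nodup_cons, List.mem_cons, Prod.mk.injEq, List.not_mem_nil, or_false,
    mul_right_inj' h3]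
  norm_num

theorem stmt_13 :
    ∃ G : MvPolynomial (Fin 4) ℝ, G ≠ 0 ∧ G.IsHomogeneous 4 ∧
      SquarefreeOnEllipsoid G ∧ (sphereRZ G).Finite ∧ (sphereRZ G).ncard = 10 := by
  classical
  have hZ : Z = (zlist.toFinset : Set (ℝ × ℝ)) := by
    rw [Z_eq]; ext; simp
  refine ⟨Gq ℝ, ?_, Gq_hom ℝ, G_sqf, ?_, ?_⟩
  · intro h
    have := congrArg (MvPolynomial.eval ![(0 : ℝ), 0, 1, 1]) h
    rw [eval_G] at this
    simp only [Matrix.cons_val] at this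
    norm_num at this
  · rw [sphere_eq, hZ]
    exact (Finset.finite_toSet _).image _
  · rw [sphere_eq, Set.ncard_image_of_injective _ pt_inj, hZ, Set.ncard_coe_finset,
      List.toFinset_card_of_nodup zlist_nodup]
    rfl
end

section
/- There exists a nonzero homogeneous polynomial G ∈ ℝ[x₀,x₁,x₂,x₃] of degree 5 whose image in ℂ[x₀,x₁,x₂,x₃]/(x₀²+x₁²+x₂²−x₃²) is a squarefree element, such that the set ℝC = {[x] ∈ ℙ³(ℝ) : x₀²+x₁²+x₂² = x₃² and G(x) = 0} is finite with exactly 15 points (a finite real curve of bidegree (5,5) on the quadric ellipsoid with 15 real points, attaining the maximum δ_e(5) = 15). -/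
open MvPolynomial

/-- The quintic form, over any commutative ring. -/
noncomputable def lensL (R : Type) [CommRing R] : MvPolynomial (Fin 4) R :=
  (X 3 + X 2) - C 1213 * (X 3 - X 2)

noncomputable def lensM (R : Type) [CommRing R] : MvPolynomial (Fin 4) R :=
  C 15588 * (X 3 + X 2) - C 172800 * (X 3 - X 2)

noncomputable def lensG (R : Type) [CommRing R] : MvPolynomial (Fin 4) R :=
  (X 3 + X 2) ^ 3 * lensL R ^ 2
    - C 2 * (X 0 ^ 3 - C 3 * (X 0 * X 1 ^ 2)) * (lensL R * lensM R)
    + (X 3 - X 2) ^ 3 * lensM R ^ 2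

lemma lensG_eval (R : Type) [CommRing R] (x : Fin 4 → R) :
    eval x (lensG R) = (x 3 + x 2) ^ 3 * ((x 3 + x 2) - 1213 * (x 3 - x 2)) ^ 2
      - 2 * (x 0 ^ 3 - 3 * (x 0 * x 1 ^ 2)) * (((x 3 + x 2) - 1213 * (x 3 - x 2)) *
        (15588 * (x 3 + x 2) - 172800 * (x 3 - x 2)))
      + (x 3 - x 2) ^ 3 * (15588 * (x 3 + x 2) - 172800 * (x 3 - x 2)) ^ 2 := by
  simp [lensG, lensL, lensM]

lemma lensG_map : MvPolynomial.map (algebraMap ℝ ℂ) (lensG ℝ) = lensG ℂ := by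
  simp [lensG, lensL, lensM]

lemma lensG_hom : (lensG ℝ).IsHomogeneous 5 := by
  have hX : ∀ i : Fin 4, (X i : MvPolynomial (Fin 4) ℝ).IsHomogeneous 1 := isHomogeneous_X ℝ
  have hC : ∀ (r : ℝ) {p : MvPolynomial (Fin 4) ℝ} {n : ℕ}, p.IsHomogeneous n →
      (C r * p).IsHomogeneous n := fun r p n hp => by
    simpa using (isHomogeneous_C (Fin 4) r).mul hp
  have hu := (hX 3).add (hX 2)
  have hv := (hX 3).sub (hX 2)
  have hL : (lensL ℝ).IsHomogeneous 1 := hu.sub (hC _ hv)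
  have hM : (lensM ℝ).IsHomogeneous 1 := (hC _ hu).sub (hC _ hv)
  have h3 : (X 0 ^ 3 - C 3 * (X 0 * X 1 ^ 2) : MvPolynomial (Fin 4) ℝ).IsHomogeneous 3 :=
    ((hX 0).pow 3).sub (hC _ ((hX 0).mul ((hX 1).pow 2)))
  exact (((hu.pow 3).mul (hL.pow 2)).sub ((hC _ h3).mul (hL.mul hM))).add
    ((hv.pow 3).mul (hM.pow 2))

lemma lensG_ne : lensG ℝ ≠ 0 := by
  intro h
  have := lensG_eval ℝ ![0, 0, 1, 1]
  rw [h] at this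
  simp only [Fin.isValue, Matrix.cons_val] at this
  norm_num at this

/-! ### Real points -/

lemma lens_cube_surj (r : ℝ) : ∃ t : ℝ, t ^ 3 = r := by
  have h : Function.Surjective (fun t : ℝ => t ^ 3) :=
    (continuous_pow 3).surjective (Filter.tendsto_pow_atTop (by norm_num))
      (by
        have h1 : Filter.Tendsto (fun t : ℝ => -((-t) ^ 3)) Filter.atBot Filter.atBot :=
          Filter.tendsto_neg_atTop_atBot.comp
            ((Filter.tendsto_pow_atTop (by norm_num)).comp Filter.tendsto_neg_atBot_atTop)
        refine h1.congr fun t => by ring)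
  exact h r

/-- Solutions of the lens equation. -/
def lensS : Set ℂ :=
  {U | U ^ 3 * ((Complex.normSq U : ℂ) - 1213) = 15588 * (Complex.normSq U : ℂ) - 172800}

def lensT : Finset ℤ := {40, 3, -4, -15, -24}

lemma lens_quintic (t : ℝ) :
    t ^ 3 * (t ^ 2 - 1213) = 15588 * t ^ 2 - 172800 ↔ ∃ n ∈ lensT, (n : ℝ) = t := by
  have : t ^ 3 * (t ^ 2 - 1213) - (15588 * t ^ 2 - 172800) =
      (t - 40) * (t - 3) * (t + 4) * (t + 15) * (t + 24) := by ring
  rw [← sub_eq_zero, this]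
  simp only [mul_eq_zero, lensT, Finset.mem_insert, Finset.mem_singleton, exists_eq_or_imp,
    exists_eq_left]
  push_cast
  constructor
  · rintro ((((h | h) | h) | h) | h)
    · left; linarith
    · right; left; linarith
    · right; right; left; linarith
    · right; right; right; left; linarith
    · right; right; right; right; linarith
  · rintro (h | h | h | h | h)
    · left; left; left; left; linarith
    · left; left; left; right; linarith
    · left; left; right; linarith
    · left; right; linarith
    · right; linarith

noncomputable def lensω : ℂ := Complex.exp (2 * Real.pi * Complex.I / (3 : ℕ))

lemma lensω_prim : IsPrimitiveRoot lensω 3 := Complex.isPrimitiveRoot_exp 3 (by norm_num)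

lemma lensω_normSq (k : ℕ) : Complex.normSq (lensω ^ k) = 1 := by
  have h : ‖lensω‖ = 1 := lensω_prim.norm'_eq_one (by norm_num)
  rw [Complex.normSq_eq_norm_sq, norm_pow, h]; simp

noncomputable def lensF (p : ℤ × Fin 3) : ℂ := ((p.1 : ℝ) : ℂ) * lensω ^ (p.2 : ℕ)

lemma lensF_cube (t : ℝ) (k : ℕ) : ((t : ℂ) * lensω ^ k) ^ 3 = ((t ^ 3 : ℝ) : ℂ) := by
  rw [mul_pow, ← pow_mul, mul_comm k 3, pow_mul, lensω_prim.pow_eq_one]; simp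

lemma lensS_eq : lensS = lensF '' ((lensT ×ˢ (Finset.univ : Finset (Fin 3)) : Finset _) : Set (ℤ × Fin 3)) := by
  ext U
  constructor
  · intro h
    simp only [lensS, Set.mem_ofPred_eq] at h
    set m := Complex.normSq U with hm
    have hmA : m - 1213 ≠ 0 := by
      intro h0
      have : m = 1213 := by linarith
      rw [this] at h
      norm_num at h
    have hU : U ^ 3 = (((15588 * m - 172800) / (m - 1213) : ℝ) : ℂ) := by
      have hmA' : (m : ℂ) - 1213 ≠ 0 := by exact_mod_cast hmA
      push_cast
      rw [eq_div_iff hmA', h]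
    obtain ⟨t, ht⟩ : ∃ t : ℝ, t ^ 3 = (15588 * m - 172800) / (m - 1213) :=
      lens_cube_surj _
    rw [← ht] at hU
    have ht0 : t ≠ 0 := by
      rintro rfl
      have : U = 0 := by
        have : U ^ 3 = 0 := by rw [hU]; norm_num
        exact pow_eq_zero_iff (by norm_num) |>.1 this
      rw [hm, this] at h
      norm_num at h
    have ht0' : (t : ℂ) ≠ 0 := by exact_mod_cast ht0
    obtain ⟨k, hk, hk'⟩ := lensω_prim.eq_pow_of_pow_eq_one (ξ := U / t)
      (by rw [div_pow, hU]; push_cast; exact div_self (pow_ne_zero _ ht0'))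
    have hUt : U = t * lensω ^ k := by rw [hk']; field_simp
    have hmt : m = t ^ 2 := by
      rw [hm, hUt, Complex.normSq_mul, lensω_normSq, Complex.normSq_ofReal]; ring
    have hq : t ^ 3 * (t ^ 2 - 1213) = 15588 * t ^ 2 - 172800 := by
      rw [ht, ← hmt]; field_simp
    obtain ⟨n, hn, rfl⟩ := (lens_quintic t).1 hq
    exact ⟨(n, ⟨k, hk⟩), by simp [hn], hUt.symm⟩
  · rintro ⟨⟨n, k⟩, hnk, rfl⟩
    have hn : n ∈ lensT := by simpa using hnk
    have hq := (lens_quintic n).2 ⟨n, hn, rfl⟩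
    have hm : Complex.normSq (lensF (n, k)) = (n : ℝ) ^ 2 := by
      simp only [lensF]
      rw [Complex.normSq_mul, lensω_normSq, Complex.normSq_ofReal]; ring
    simp only [lensS, Set.mem_ofPred_eq, hm]
    simp only [lensF]
    rw [lensF_cube]
    exact_mod_cast hq

lemma lensF_inj : Function.Injective.{1,1} (fun p : {p : ℤ × Fin 3 // p.1 ≠ 0} => lensF p.1) := by
  rintro ⟨⟨n, k⟩, hn⟩ ⟨⟨n', k'⟩, hn'⟩ h
  simp only [lensF] at h
  have h3 := congrArg (· ^ 3) h
  simp only [lensF_cube] at h3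
  have h4 : (n : ℝ) ^ 3 = (n' : ℝ) ^ 3 := by exact_mod_cast h3
  have h5 : (n : ℝ) = n' := (Odd.strictMono_pow (R := ℝ) (n := 3) (by decide)).injective h4
  have h6 : n = n' := by exact_mod_cast h5
  subst h6
  have hn0 : ((n : ℝ) : ℂ) ≠ 0 := by exact_mod_cast hn
  have h7 := mul_left_cancel₀ hn0 h
  have := lensω_prim.pow_inj k.2 k'.2 h7
  simp [Fin.ext this]

lemma lensS_card : lensS.ncard = 15 := by
  rw [lensS_eq, Set.InjOn.ncard_image, Set.ncard_coe_finset]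
  · rfl
  · intro p hp q hq h
    have key : ∀ p ∈ (lensT ×ˢ (Finset.univ : Finset (Fin 3)) : Finset (ℤ × Fin 3)), p.1 ≠ 0 := by
      decide
    have := @lensF_inj ⟨p, key p hp⟩ ⟨q, key q hq⟩ h
    exact congrArg Subtype.val this

lemma lensS_finite : lensS.Finite := Set.finite_of_ncard_ne_zero (by rw [lensS_card]; norm_num)

noncomputable def lensVec (U : ℂ) : Fin 4 → ℝ :=
  ![U.re, U.im, (Complex.normSq U - 1) / 2, (Complex.normSq U + 1) / 2]

lemma lensVec_ne (U : ℂ) : lensVec U ≠ 0 := by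
  intro h
  have h2 := congrFun h 2
  have h3 := congrFun h 3
  simp [lensVec] at h2 h3
  linarith

noncomputable def lensPt (U : ℂ) : Projectivization ℝ (Fin 4 → ℝ) :=
  Projectivization.mk ℝ (lensVec U) (lensVec_ne U)

lemma lensPt_inj : Function.Injective lensPt := by
  intro U V h
  rw [lensPt, lensPt, Projectivization.mk_eq_mk_iff'] at h
  obtain ⟨a, ha⟩ := h
  have h0 := congrFun ha 0
  have h1 := congrFun ha 1
  have h2 := congrFun ha 2
  have h3 := congrFun ha 3
  simp [lensVec] at h0 h1 h2 h3
  have : a = 1 := by linarith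
  subst this
  apply Complex.ext <;> linarith

/-- The value of the form at a real vector of the sphere. -/
lemma lens_value (U : ℂ) : eval (lensVec U) (lensG ℝ) = 0 ↔ U ∈ lensS := by
  have key : eval (lensVec U) (lensG ℝ) = Complex.normSq
      (U ^ 3 * ((Complex.normSq U : ℂ) - 1213) - (15588 * (Complex.normSq U : ℂ) - 172800)) := by
    rw [lensG_eval]
    have e1 : U ^ 3 * ((Complex.normSq U : ℂ) - 1213) - (15588 * (Complex.normSq U : ℂ) - 172800)
      = ⟨(U.re ^ 3 - 3 * (U.re * U.im ^ 2)) * (Complex.normSq U - 1213) -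
          (15588 * Complex.normSq U - 172800),
        (3 * U.re ^ 2 * U.im - U.im ^ 3) * (Complex.normSq U - 1213)⟩ := by
      apply Complex.ext <;> simp [pow_succ, -mul_eq_mul_right_iff, -mul_eq_mul_left_iff] <;> ring
    rw [e1, Complex.normSq_mk]
    simp only [lensVec, Complex.normSq_apply]
    simp
    ring
  rw [key, Complex.normSq_eq_zero, sub_eq_zero]
  rfl

lemma lens_scale (c : ℝ) (x : Fin 4 → ℝ) :
    eval (c • x) (lensG ℝ) = c ^ 5 * eval x (lensG ℝ) := by
  simp only [lensG_eval, Pi.smul_apply, smul_eq_mul]; ring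

lemma sphereRZ_lens : sphereRZ (lensG ℝ) = lensPt '' lensS := by
  ext x
  constructor
  · rintro ⟨hs, hG⟩
    have hv : x.rep 3 - x.rep 2 ≠ 0 := by
      intro hv
      have h32 : x.rep 3 = x.rep 2 := by linarith
      rw [h32] at hs
      have h0 : x.rep 0 = 0 := by nlinarith [sq_nonneg (x.rep 0), sq_nonneg (x.rep 1)]
      have h1 : x.rep 1 = 0 := by nlinarith [sq_nonneg (x.rep 0), sq_nonneg (x.rep 1)]
      rw [lensG_eval, hv, h0, h32] at hG
      have h2 : x.rep 2 = 0 := by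
        have : x.rep 2 ^ 5 = 0 := by linear_combination hG / 32
        exact pow_eq_zero_iff (by norm_num) |>.1 this
      apply x.rep_nonzero
      ext i
      fin_cases i <;> simp [h0, h1, h2, h32]
    set v := x.rep 3 - x.rep 2 with hvdef
    have hrep : x.rep = v • lensVec ⟨x.rep 0 / v, x.rep 1 / v⟩ := by
      have hn : Complex.normSq ⟨x.rep 0 / v, x.rep 1 / v⟩ = (x.rep 3 + x.rep 2) / v := by
        rw [Complex.normSq_mk]
        field_simp
        rw [hvdef]; linear_combination hs
      ext i
      fin_cases i
      · simp [lensVec]; field_simp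
      · simp [lensVec]; field_simp
      · simp [lensVec, hn]; field_simp; rw [hvdef]; ring
      · simp [lensVec, hn]; field_simp; rw [hvdef]; ring
    refine ⟨⟨x.rep 0 / v, x.rep 1 / v⟩, ?_, ?_⟩
    · rw [← lens_value]
      rw [hrep, lens_scale] at hG
      exact (mul_eq_zero.1 hG).resolve_left (pow_ne_zero _ hv)
    · conv_rhs => rw [← x.mk_rep]
      rw [lensPt, Projectivization.mk_eq_mk_iff']
      exact ⟨v⁻¹, by conv_lhs => rw [hrep, smul_smul, inv_mul_cancel₀ hv, one_smul]⟩
  · rintro ⟨U, hU, rfl⟩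
    obtain ⟨a, ha⟩ := Projectivization.exists_smul_eq_mk_rep ℝ (lensVec U) (lensVec_ne U)
    have ha' : (lensPt U).rep = (a : ℝ) • lensVec U := ha.symm
    refine ⟨?_, ?_⟩
    · rw [ha']
      simp [lensVec, Complex.normSq_apply]; ring
    · rw [ha', lens_scale, (lens_value U).2 hU, mul_zero]

/-! ### Squarefreeness -/

/-- Points of the quadric cone in the affine chart. -/
noncomputable def coneP (s z w : ℂ) : Fin 4 → ℂ :=
  ![s * (z + w) / 2, s * (z - w) / (2 * Complex.I), s * (z * w - 1) / 2, s * (z * w + 1) / 2]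

def lensp (z w : ℂ) : ℂ := z ^ 3 * (z * w - 1213) - (15588 * (z * w) - 172800)

lemma coneP_G (s z w : ℂ) :
    eval (coneP s z w) (lensG ℂ) = s ^ 5 * (lensp z w * lensp w z) := by
  rw [lensG_eval]
  have hI : Complex.I ^ 2 = -1 := Complex.I_sq
  have h1 : (s * (z - w) / (2 * Complex.I)) ^ 2 = - (s * (z - w)) ^ 2 / 4 := by
    rw [div_pow, mul_pow 2, hI]; ring
  simp only [coneP, lensp]
  simp only [Fin.isValue, Matrix.cons_val]
  rw [h1]
  ring

lemma coneP_Q (s z w : ℂ) : eval (coneP s z w) Qc = 0 := by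
  have hI : Complex.I ^ 2 = -1 := Complex.I_sq
  have h1 : (s * (z - w) / (2 * Complex.I)) ^ 2 = - (s * (z - w)) ^ 2 / 4 := by
    rw [div_pow, mul_pow 2, hI]; ring
  simp [Qc, coneP, h1]
  ring

/-- Every point of the cone with `x₃ ≠ x₂` is in the chart. -/
lemma exists_coneP (x : Fin 4 → ℂ) (hQ : x 0 ^ 2 + x 1 ^ 2 + x 2 ^ 2 - x 3 ^ 2 = 0)
    (hv : x 3 - x 2 ≠ 0) : ∃ z w, x = coneP (x 3 - x 2) z w := by
  have hI : Complex.I ^ 2 = -1 := Complex.I_sq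
  refine ⟨(x 0 + Complex.I * x 1) / (x 3 - x 2), (x 0 - Complex.I * x 1) / (x 3 - x 2), ?_⟩
  have hI0 := Complex.I_ne_zero
  have hzw : (x 0 + Complex.I * x 1) / (x 3 - x 2) * ((x 0 - Complex.I * x 1) / (x 3 - x 2))
      = (x 3 + x 2) / (x 3 - x 2) := by
    field_simp
    linear_combination hQ - x 1 ^ 2 * hI
  ext i
  simp only [coneP, hzw]
  fin_cases i
  · simp; field_simp; ring
  · simp; field_simp; ring
  · simp; field_simp; ring
  · simp; field_simp; ring

lemma mem_span_Qc (p : MvPolynomial (Fin 4) ℂ)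
    (hp : ∀ s z w : ℂ, s ≠ 0 → eval (coneP s z w) p = 0) : p ∈ Ideal.span {Qc} := by
  set q : MvPolynomial (Fin 3) ℂ := X 0 ^ 2 + X 1 ^ 2 - X 2 ^ 2 with hq
  set M : Polynomial (MvPolynomial (Fin 3) ℂ) := Polynomial.X ^ 2 + Polynomial.C q with hM
  have hmonic : M.Monic := Polynomial.monic_X_pow_add_C q (by norm_num)
  have hMQ : finSuccEquiv ℂ 3 Qc = M := by
    have e1 : (1 : Fin 4) = Fin.succ 0 := rfl
    have e2 : (2 : Fin 4) = Fin.succ 1 := rfl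
    have e3 : (3 : Fin 4) = Fin.succ 2 := rfl
    simp only [Qc, map_add, map_sub, map_pow, finSuccEquiv_X_zero, e1, e2, e3,
      finSuccEquiv_X_succ, hM, hq]
    ring
  set P := finSuccEquiv ℂ 3 p with hP
  have hdeg : (P %ₘ M).degree < 2 := by
    have := Polynomial.degree_modByMonic_lt P hmonic
    rwa [hM, Polynomial.degree_X_pow_add_C (by norm_num)] at this
  set A := (P %ₘ M).coeff 0 with hA
  set B := (P %ₘ M).coeff 1 with hB
  have hr : P %ₘ M = Polynomial.C B * Polynomial.X + Polynomial.C A := by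
    apply Polynomial.eq_X_add_C_of_degree_le_one
    exact Order.le_of_lt_succ hdeg
  have hdecomp : P = M * (P /ₘ M) + (Polynomial.C B * Polynomial.X + Polynomial.C A) := by
    rw [← hr, add_comm]; exact (Polynomial.modByMonic_add_div P M).symm
  have hev : ∀ (a : ℂ) (y : Fin 3 → ℂ), y 2 - y 1 ≠ 0 → a ^ 2 + eval y q = 0 →
      eval y B * a + eval y A = 0 := by
    intro a y hv ha
    have h0 : eval (Fin.cons a y) p = 0 := by
      obtain ⟨z, w, h⟩ := exists_coneP (Fin.cons a y)
        (by
          have : eval y q = y 0 ^ 2 + y 1 ^ 2 - y 2 ^ 2 := by simp [hq]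
          rw [this] at ha
          change a ^ 2 + y 0 ^ 2 + y 1 ^ 2 - y 2 ^ 2 = 0
          linear_combination ha) hv
      rw [h]
      exact hp _ _ _ hv
    rw [eval_eq_eval_mv_eval', ← hP, hdecomp] at h0
    simpa [hM, ha] using h0
  have hAB : ∀ y : Fin 3 → ℂ, y 2 - y 1 ≠ 0 → eval y A = 0 ∧ eval y B * eval y q = 0 := by
    intro y hv
    obtain ⟨a, ha⟩ := IsAlgClosed.exists_pow_nat_eq (-(eval y q)) (n := 2) (by norm_num)
    have h1 := hev a y hv (by rw [ha]; ring)
    have h2 := hev (-a) y hv (by rw [neg_sq, ha]; ring)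
    refine ⟨by linear_combination (h1 + h2) / 2, ?_⟩
    linear_combination (-a / 2) * (h1 - h2) + eval y B * ha
  have hv0 : (X 2 - X 1 : MvPolynomial (Fin 3) ℂ) ≠ 0 := by
    intro h
    have := congrArg (eval ![0, 0, 1]) h
    simp at this
  have hq0 : q ≠ 0 := by
    intro h
    have := congrArg (eval ![0, 0, 1]) h
    simp [hq] at this
  have hA0 : A = 0 := by
    have : (X 2 - X 1) * A = 0 := by
      apply MvPolynomial.funext
      intro y
      by_cases hv : y 2 - y 1 = 0
      · simp [hv]
      · simp [(hAB y hv).1]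
    exact (mul_eq_zero.1 this).resolve_left hv0
  have hB0 : B = 0 := by
    have : (X 2 - X 1) * (B * q) = 0 := by
      apply MvPolynomial.funext
      intro y
      by_cases hv : y 2 - y 1 = 0
      · simp [hv]
      · rw [map_mul, map_mul, (hAB y hv).2]; simp
    exact (mul_eq_zero.1 ((mul_eq_zero.1 this).resolve_left hv0)).resolve_right hq0
  rw [Ideal.mem_span_singleton]
  refine ⟨(finSuccEquiv ℂ 3).symm (P /ₘ M), ?_⟩
  apply (finSuccEquiv ℂ 3).injective
  rw [map_mul, hMQ, AlgEquiv.apply_symm_apply, ← hP]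
  conv_lhs => rw [hdecomp]
  simp [hA0, hB0]

lemma ev_sub {σ τ : Type} (g : σ → MvPolynomial τ ℂ) (p : MvPolynomial σ ℂ) (y : τ → ℂ) :
    eval y (aeval g p) = eval (fun i => eval y (g i)) p := by
  induction p using MvPolynomial.induction_on <;> simp_all [algebraMap_eq]

lemma ev_subp {σ : Type} (g : σ → Polynomial ℂ) (p : MvPolynomial σ ℂ) (y : ℂ) :
    Polynomial.eval y (aeval g p) = eval (fun i => Polynomial.eval y (g i)) p := by
  induction p using MvPolynomial.induction_on <;> simp_all

noncomputable def lensTp : Polynomial ℂ :=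
  Polynomial.X ^ 6 * (Polynomial.X ^ 3 - Polynomial.C 15588) ^ 3 -
    (Polynomial.C 1213 * Polynomial.X ^ 3 - Polynomial.C 172800) ^ 3

noncomputable def lensNp : Polynomial ℂ :=
  (Polynomial.C 4 * Polynomial.X ^ 3 - Polynomial.C 15588) *
    (Polynomial.C 1213 * Polynomial.X ^ 3 - Polynomial.C 172800) -
  Polynomial.C 3639 * Polynomial.X ^ 2 * (Polynomial.X ^ 4 - Polynomial.C 15588 * Polynomial.X)

def lensBad : Set ℂ :=
  {z | lensTp.IsRoot z} ∪
    (fun w : ℂ => (1213 * w ^ 3 - 172800) / (w ^ 4 - 15588 * w)) '' {w | lensNp.IsRoot w}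

lemma lensBad_finite : lensBad.Finite := by
  apply Set.Finite.union
  · apply Polynomial.finite_setOfPred_isRoot
    intro h
    have := congrArg (Polynomial.eval 0) h
    simp [lensTp] at this
  · apply Set.Finite.image
    apply Polynomial.finite_setOfPred_isRoot
    intro h
    have := congrArg (Polynomial.eval 0) h
    simp [lensNp] at this

lemma lens_bad (z w : ℂ) (h0 : lensp z w * lensp w z = 0)
    (h1 : (z ^ 4 - 15588 * z) * lensp w z +
      lensp z w * (4 * z * w ^ 3 - 3639 * w ^ 2 - 15588 * z) = 0) : z ∈ lensBad := by
  by_cases hp : lensp z w = 0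
  · left
    rw [hp, zero_mul, add_zero] at h1
    have hq : lensp w z = 0 := by
      refine (mul_eq_zero.1 h1).resolve_left fun h => ?_
      have h2 : 1213 * z ^ 3 = 172800 := by
        simp only [lensp] at hp
        linear_combination w * h - hp
      have h3 : z * (z ^ 3 - 15588) = 0 := by linear_combination h
      rcases mul_eq_zero.1 h3 with h4 | h4
      · rw [h4] at h2; norm_num at h2
      · have h5 : z ^ 3 = 15588 := by linear_combination h4
        rw [h5] at h2; norm_num at h2
    simp only [lensp] at hp hq
    have hm : z * w - 1213 ≠ 0 := by
      intro h
      have : (15588 * 1213 - 172800 : ℂ) = 0 := by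
        linear_combination (z ^ 3 - 15588) * h - hp
      norm_num at this
    have hzw : w ^ 3 = z ^ 3 := by
      apply mul_right_cancel₀ hm
      linear_combination hq - hp
    have h5 : z * w * (z ^ 3 - 15588) = 1213 * z ^ 3 - 172800 := by linear_combination hp
    simp only [Set.mem_ofPred_eq, Polynomial.IsRoot, lensTp]
    simp
    rw [← h5, mul_pow, mul_pow, hzw]
    ring
  · right
    have hq := (mul_eq_zero.1 h0).resolve_left hp
    rw [hq, mul_zero, zero_add] at h1
    have h2 := (mul_eq_zero.1 h1).resolve_left hp
    simp only [lensp] at hq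
    refine ⟨w, ?_, ?_⟩
    · simp only [Set.mem_ofPred_eq, Polynomial.IsRoot, lensNp]
      simp
      linear_combination (w ^ 4 - 15588 * w) * h2 - (4 * w ^ 3 - 15588) * hq
    · have hd : w ^ 4 - 15588 * w ≠ 0 := by
        intro h
        have h3 : 1213 * w ^ 3 = 172800 := by linear_combination z * h - hq
        have h4 : w * (w ^ 3 - 15588) = 0 := by linear_combination h
        rcases mul_eq_zero.1 h4 with h5 | h5
        · rw [h5] at h3; norm_num at h3
        · have h6 : w ^ 3 = 15588 := by linear_combination h5
          rw [h6] at h3; norm_num at h3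
      simp only
      rw [div_eq_iff hd]
      linear_combination -hq

lemma lens_indep (f h : MvPolynomial (Fin 2) ℂ) (K : ℂ) (hK : K ≠ 0)
    (H : ∀ z w, eval ![z, w] f ^ 2 * eval ![z, w] h = K * (lensp z w * lensp w z)) (z w : ℂ) :
    eval ![z, w] f = eval ![z, 0] f := by
  have e1 : ∀ (p : MvPolynomial (Fin 2) ℂ) (z w : ℂ),
      Polynomial.eval w (aeval ![Polynomial.C z, Polynomial.X] p) = eval ![z, w] p := by
    intro p z w
    rw [ev_subp]; congr 2; ext i; fin_cases i <;> simp
  have e2 : ∀ (p : MvPolynomial (Fin 2) ℂ) (z w : ℂ),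
      Polynomial.eval z (aeval ![Polynomial.X, Polynomial.C w] p) = eval ![z, w] p := by
    intro p z w
    rw [ev_subp]; congr 2; ext i; fin_cases i <;> simp
  have good : ∀ z ∉ lensBad, ∀ w, eval ![z, w] f = eval ![z, 0] f := by
    intro z hz w
    set F : Polynomial ℂ := aeval ![Polynomial.C z, Polynomial.X] f with hF
    set Hh : Polynomial ℂ := aeval ![Polynomial.C z, Polynomial.X] h with hHh
    set P1 : Polynomial ℂ := Polynomial.C (z ^ 3) * (Polynomial.C z * Polynomial.X -
      Polynomial.C 1213) - (Polynomial.C 15588 * (Polynomial.C z * Polynomial.X) -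
      Polynomial.C 172800) with hP1
    set P2 : Polynomial ℂ := Polynomial.X ^ 3 * (Polynomial.C z * Polynomial.X -
      Polynomial.C 1213) - (Polynomial.C 15588 * (Polynomial.C z * Polynomial.X) -
      Polynomial.C 172800) with hP2
    have hP1e : ∀ w, P1.eval w = lensp z w := by intro w; simp [hP1, lensp]
    have hP2e : ∀ w, P2.eval w = lensp w z := by intro w; simp [hP2, lensp]; ring
    have hid : F ^ 2 * Hh = Polynomial.C K * (P1 * P2) := by
      apply Polynomial.funext
      intro w
      simp only [Polynomial.eval_mul, Polynomial.eval_pow, Polynomial.eval_C, hP1e, hP2e]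
      rw [hF, hHh, e1, e1, H]
    have hdeg : F.degree = 0 := by
      by_contra hd
      obtain ⟨w0, hw0⟩ := IsAlgClosed.exists_root F hd
      apply hz
      have hw0' : F.eval w0 = 0 := hw0
      apply lens_bad z w0
      · have := congrArg (Polynomial.eval w0) hid
        simp only [Polynomial.eval_mul, Polynomial.eval_pow, Polynomial.eval_C, hP1e, hP2e,
          hw0'] at this
        have h' : K * (lensp z w0 * lensp w0 z) = 0 := by rw [← this]; ring
        exact (mul_eq_zero.1 h').resolve_left hK
      · have := congrArg (fun p => Polynomial.eval w0 (Polynomial.derivative p)) hid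
        simp only [Polynomial.derivative_mul, Polynomial.derivative_pow, Polynomial.eval_mul,
          Polynomial.eval_add, Polynomial.eval_pow, Polynomial.eval_C, hP1e, hP2e,
          hw0', Polynomial.derivative_C, Polynomial.eval_zero] at this
        have d1 : (Polynomial.derivative P1).eval w0 = z ^ 4 - 15588 * z := by
          simp [hP1, -map_pow]; ring
        have d2 : (Polynomial.derivative P2).eval w0 =
            4 * z * w0 ^ 3 - 3639 * w0 ^ 2 - 15588 * z := by
          simp [hP2]; ring
        rw [d1, d2] at this
        have h' : K * ((z ^ 4 - 15588 * z) * lensp w0 z +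
            lensp z w0 * (4 * z * w0 ^ 3 - 3639 * w0 ^ 2 - 15588 * z)) = 0 := by
          linear_combination -this
        exact (mul_eq_zero.1 h').resolve_left hK
    have hc := Polynomial.eq_C_of_degree_eq_zero hdeg
    rw [← e1, ← e1, ← hF, hc]
    simp
  have hzero : (aeval ![Polynomial.X, Polynomial.C w] f -
      aeval ![Polynomial.X, Polynomial.C 0] f : Polynomial ℂ) = 0 := by
    apply Polynomial.eq_zero_of_infinite_isRoot
    refine lensBad_finite.infinite_compl.mono ?_
    intro z hz
    simp only [Set.mem_ofPred_eq, Polynomial.IsRoot]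
    rw [Polynomial.eval_sub, e2, e2, good z hz w, sub_self]
  have := congrArg (Polynomial.eval z) hzero
  rw [Polynomial.eval_sub, e2, e2, Polynomial.eval_zero] at this
  exact sub_eq_zero.1 this

lemma lens_squarefree : SquarefreeOnEllipsoid (lensG ℝ) := by
  rw [SquarefreeOnEllipsoid, lensG_map]
  intro x hx
  obtain ⟨y, hy⟩ := hx
  obtain ⟨p, rfl⟩ := Ideal.Quotient.mk_surjective x
  obtain ⟨r, rfl⟩ := Ideal.Quotient.mk_surjective y
  rw [← map_mul, ← map_mul, Ideal.Quotient.eq, Ideal.mem_span_singleton] at hy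
  obtain ⟨q, hq⟩ := hy
  have hpr : ∀ x, eval x Qc = 0 → eval x p ^ 2 * eval x r = eval x (lensG ℂ) := by
    intro x hx
    have := congrArg (eval x) hq
    simp only [map_sub, map_mul, hx] at this
    linear_combination -this
  -- restriction to each affine slice is constant
  have hconst : ∀ s z w : ℂ, s ≠ 0 → eval (coneP s z w) p = eval (coneP s 0 0) p := by
    intro s z w hs
    set g : Fin 4 → MvPolynomial (Fin 2) ℂ :=
      ![C (s / 2) * (X 0 + X 1), C (s / (2 * Complex.I)) * (X 0 - X 1),
        C (s / 2) * (X 0 * X 1 - 1), C (s / 2) * (X 0 * X 1 + 1)] with hg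
    have hge : ∀ (P : MvPolynomial (Fin 4) ℂ) (z w : ℂ),
        eval ![z, w] (aeval g P) = eval (coneP s z w) P := by
      intro P z w
      rw [ev_sub]; congr 2; ext i
      fin_cases i <;> simp [hg, coneP] <;> ring
    set g' : Fin 4 → MvPolynomial (Fin 2) ℂ :=
      ![C (s / 2) * (X 1 + X 0), C (s / (2 * Complex.I)) * (X 1 - X 0),
        C (s / 2) * (X 1 * X 0 - 1), C (s / 2) * (X 1 * X 0 + 1)] with hg'
    have hge' : ∀ (P : MvPolynomial (Fin 4) ℂ) (z w : ℂ),
        eval ![z, w] (aeval g' P) = eval (coneP s w z) P := by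
      intro P z w
      rw [ev_sub]; congr 2; ext i
      fin_cases i <;> simp [hg', coneP] <;> ring
    have h1 := lens_indep (aeval g p) (aeval g r) (s ^ 5) (pow_ne_zero _ hs)
      (by intro z w; rw [hge, hge, hpr _ (coneP_Q s z w), coneP_G])
    have h2 := lens_indep (aeval g' p) (aeval g' r) (s ^ 5) (pow_ne_zero _ hs)
      (by intro z w; rw [hge', hge', hpr _ (coneP_Q s w z), coneP_G]; ring)
    have h3 := h1 z w
    have h4 := h2 0 z
    rw [hge, hge] at h3
    rw [hge', hge'] at h4
    rw [h3, h4]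
  -- the value at the slice `s`
  set gp : Polynomial ℂ := aeval (![0, 0, Polynomial.C (-1 / 2) * Polynomial.X,
    Polynomial.C (1 / 2) * Polynomial.X] : Fin 4 → Polynomial ℂ) p with hgp
  have hgpe : ∀ s, gp.eval s = eval (coneP s 0 0) p := by
    intro s
    rw [hgp, ev_subp]; congr 2; ext i
    fin_cases i <;> simp [coneP] <;> ring
  have hroot : ∀ s, gp.eval s ≠ 0 := by
    intro s h0
    by_cases hs : s = 0
    · subst hs
      set kp : Polynomial ℂ := aeval (![Polynomial.X, 0,
        Polynomial.C (1 / 2) * (1 - Polynomial.X ^ 2),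
        Polynomial.C (1 / 2) * (1 + Polynomial.X ^ 2)] : Fin 4 → Polynomial ℂ) p
        - gp.comp (Polynomial.X ^ 2) with hkp
      have hke : ∀ t, kp.eval t = eval ![t, 0, (1 - t ^ 2) / 2, (1 + t ^ 2) / 2] p
          - gp.eval (t ^ 2) := by
        intro t
        rw [hkp, Polynomial.eval_sub, ev_subp, Polynomial.eval_comp]
        congr 1
        · congr 2; ext i
          fin_cases i <;> simp <;> ring
        · simp
      have hk0 : kp = 0 := by
        apply Polynomial.eq_zero_of_infinite_isRoot
        refine (Set.finite_singleton (0 : ℂ)).infinite_compl.mono ?_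
        intro t ht
        have ht0 : t ≠ 0 := ht
        simp only [Set.mem_ofPred_eq, Polynomial.IsRoot]
        rw [hke, hgpe, ← hconst (t ^ 2) (1 / t) (1 / t) (pow_ne_zero _ ht0), sub_eq_zero]
        congr 2; ext i
        fin_cases i <;> simp [coneP] <;> field_simp <;> norm_num
      have h1 := hke 0
      rw [hk0] at h1
      have h2 : eval ![0, 0, 1 / 2, 1 / 2] p = 0 := by
        simpa [h0] using h1.symm
      have h3 := hpr ![0, 0, 1 / 2, 1 / 2] (by simp [Qc])
      rw [h2, lensG_eval] at h3
      simp only [Fin.isValue, Matrix.cons_val] at h3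
      norm_num at h3
    · have h1 := hpr _ (coneP_Q s 0 0)
      rw [coneP_G, ← hgpe, h0] at h1
      simp [lensp, hs] at h1
  have hdeg : gp.degree = 0 := by
    by_contra hd
    obtain ⟨s, hs⟩ := IsAlgClosed.exists_root gp hd
    exact hroot s hs
  have hc := Polynomial.eq_C_of_degree_eq_zero hdeg
  have hl : gp.coeff 0 ≠ 0 := by
    have := hroot 0
    rwa [← Polynomial.coeff_zero_eq_eval_zero] at this
  have hmem : p - C (gp.coeff 0) ∈ Ideal.span {Qc} := by
    apply mem_span_Qc
    intro s z w hs
    rw [map_sub, hconst s z w hs, ← hgpe, hc]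
    simp
  rw [Ideal.Quotient.eq.2 hmem]
  exact ((isUnit_iff_ne_zero.2 hl).map (C : ℂ →+* MvPolynomial (Fin 4) ℂ)).map _

theorem stmt_14 :
    ∃ G : MvPolynomial (Fin 4) ℝ, G ≠ 0 ∧ G.IsHomogeneous 5 ∧
      SquarefreeOnEllipsoid G ∧ (sphereRZ G).Finite ∧ (sphereRZ G).ncard = 15 := by
  refine ⟨lensG ℝ, lensG_ne, lensG_hom, lens_squarefree, ?_, ?_⟩
  · rw [sphereRZ_lens]
    exact lensS_finite.image _
  · rw [sphereRZ_lens, Set.ncard_image_of_injective _ lensPt_inj, lensS_card]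
end

section
/- For every integer b ≥ 0 there exists a nonzero bihomogeneous polynomial F ∈ ℝ[x₀,x₁,y₀,y₁] of bidegree (2, 2b), squarefree over ℂ, such that the real zero set ℝZ(F) = {([x],[y]) ∈ ℙ¹(ℝ)×ℙ¹(ℝ) : F(x,y) = 0} is finite with exactly 2b points. (This is the n = 0 case of the proposition that for all b, n ≥ 0 there is a finite real curve of bidegree (2, 2b) in the Hirzebruch surface Σ_n with n + 2b real points; the curve is the union of two complex conjugate members of a real pencil of curves of bidegree (1, b).) -/
open MvPolynomial

/-- `F ∈ R[x₀,x₁,y₀,y₁]` is bihomogeneous of bidegree `(d₁, d₂)`: every monomial of `F`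
has degree `d₁` in `(x₀,x₁)` and degree `d₂` in `(y₀,y₁)`. -/
def Bihomogeneous {R : Type*} [CommSemiring R]
    (F : MvPolynomial (Fin 4) R) (d₁ d₂ : ℕ) : Prop :=
  ∀ d ∈ F.support, d 0 + d 1 = d₁ ∧ d 2 + d 3 = d₂

/-- The real zero set of a bihomogeneous polynomial in `ℙ¹(ℝ) × ℙ¹(ℝ)`. -/
noncomputable def RZ2 (F : MvPolynomial (Fin 4) ℝ) :
    Set (Projectivization ℝ (Fin 2 → ℝ) × Projectivization ℝ (Fin 2 → ℝ)) :=
  {p | MvPolynomial.eval ![p.1.rep 0, p.1.rep 1, p.2.rep 0, p.2.rep 1] F = 0}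

/-- The set of singular points of the curve `{Q = 0} ⊂ ℙ¹(ℂ) × ℙ¹(ℂ)`: points at which
all four partial derivatives of `Q` vanish. -/
noncomputable def SingSet2 (Q : MvPolynomial (Fin 4) ℂ) :
    Set (Projectivization ℂ (Fin 2 → ℂ) × Projectivization ℂ (Fin 2 → ℂ)) :=
  {p | ∀ i : Fin 4,
    MvPolynomial.eval ![p.1.rep 0, p.1.rep 1, p.2.rep 0, p.2.rep 1] (pderiv i Q) = 0}

/-- The point `p` is a node of the curve `{Q = 0} ⊂ ℙ¹(ℂ) × ℙ¹(ℂ)`: the `4×4` complex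
Hessian matrix of `Q` at (representatives of) `p` has rank `2`. -/
noncomputable def IsNodeAt2 (Q : MvPolynomial (Fin 4) ℂ)
    (p : Projectivization ℂ (Fin 2 → ℂ) × Projectivization ℂ (Fin 2 → ℂ)) : Prop :=
  (Matrix.of fun i j : Fin 4 =>
    MvPolynomial.eval ![p.1.rep 0, p.1.rep 1, p.2.rep 0, p.2.rep 1]
      (pderiv i (pderiv j Q))).rank = 2

/-- Linear form `y₀ - c y₁`. -/
noncomputable def lin19 (R : Type*) [CommRing R] (c : ℤ) : MvPolynomial (Fin 4) R :=
  X 2 - C (c : R) * X 3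

noncomputable def AA19 (R : Type*) [CommRing R] (b : ℕ) : MvPolynomial (Fin 4) R :=
  ∏ i : Fin b, lin19 R (i : ℕ)

noncomputable def BB19 (R : Type*) [CommRing R] (b : ℕ) : MvPolynomial (Fin 4) R :=
  ∏ i : Fin b, lin19 R (-((i : ℕ) + 1 : ℤ))

noncomputable def F19 (R : Type*) [CommRing R] (b : ℕ) : MvPolynomial (Fin 4) R :=
  X 0 ^ 2 * AA19 R b ^ 2 + X 1 ^ 2 * BB19 R b ^ 2

lemma map_F19 (b : ℕ) : MvPolynomial.map (algebraMap ℝ ℂ) (F19 ℝ b) = F19 ℂ b := by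
  simp [F19, AA19, BB19, lin19, map_prod]

def w19 : Fin 4 → ℕ × ℕ := ![(1,0),(1,0),(0,1),(0,1)]

lemma lin19_hom (c : ℤ) : IsWeightedHomogeneous w19 (lin19 ℝ c) (0,1) := by
  have h2 : IsWeightedHomogeneous w19 (X 2 : MvPolynomial (Fin 4) ℝ) (0,1) :=
    isWeightedHomogeneous_X ℝ w19 2
  have h3 : IsWeightedHomogeneous w19 (X 3 : MvPolynomial (Fin 4) ℝ) (0,1) :=
    isWeightedHomogeneous_X ℝ w19 3
  have h4 := (isWeightedHomogeneous_C w19 (-(c : ℝ))).mul h3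
  rw [zero_add] at h4
  have := h2.add h4
  rw [lin19, sub_eq_add_neg, ← neg_mul, ← C_neg]
  exact this

lemma prod19_hom (b : ℕ) (c : Fin b → ℤ) :
    IsWeightedHomogeneous w19 (∏ i, lin19 ℝ (c i)) (0,b) := by
  have := IsWeightedHomogeneous.prod Finset.univ (fun i => lin19 ℝ (c i)) (fun _ => (0,1))
    (w := w19) (fun i _ => lin19_hom (c i))
  simpa using this

lemma F19_bihom (b : ℕ) : Bihomogeneous (F19 ℝ b) 2 (2 * b) := by
  have h0 : IsWeightedHomogeneous w19 (X 0 : MvPolynomial (Fin 4) ℝ) (1,0) :=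
    isWeightedHomogeneous_X ℝ w19 0
  have h1 : IsWeightedHomogeneous w19 (X 1 : MvPolynomial (Fin 4) ℝ) (1,0) :=
    isWeightedHomogeneous_X ℝ w19 1
  have hA : IsWeightedHomogeneous w19 (F19 ℝ b) (2, 2 * b) := by
    have e : ((2, 2 * b) : ℕ × ℕ) = 2 • (1,0) + 2 • (0,b) := by simp
    rw [e]
    exact ((h0.pow 2).mul ((prod19_hom b _).pow 2)).add ((h1.pow 2).mul ((prod19_hom b _).pow 2))
  intro d hd
  have := hA (mem_support_iff.mp hd)
  rw [Finsupp.weight_apply, Finsupp.sum_fintype _ _ (by simp)] at this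
  simpa [Fin.sum_univ_four, w19, Prod.ext_iff] using this

lemma F19_eval_one (b : ℕ) : eval ![0, 1, 1, 0] (F19 ℂ b) = 1 := by
  simp [F19, AA19, BB19, lin19, map_prod]

lemma F19_ne (b : ℕ) : F19 ℝ b ≠ 0 := by
  intro h
  have : eval ![0, 1, 1, 0] (F19 ℝ b) = 1 := by
    simp [F19, AA19, BB19, lin19, map_prod]
  rw [h] at this
  simp at this

lemma not_dvd_X19 {p : MvPolynomial (Fin 4) ℂ} (hp : Prime p) {i : Fin 4} (h : p ∣ X i)
    (q : MvPolynomial (Fin 4) ℂ) (v : Fin 4 → ℂ) (hv : v i = 0) (hq : eval v q ≠ 0) :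
    ¬ p ∣ q := by
  intro h'
  have hX : Irreducible (X i : MvPolynomial (Fin 4) ℂ) := MvPolynomial.X_prime.irreducible
  have : X i ∣ p := ((hX.dvd_iff.mp h).resolve_left hp.not_isUnit).dvd
  obtain ⟨r, rfl⟩ := this.trans h'
  simp [hv] at hq

lemma pderiv_prod19 (i : Fin 4) (hi : i = 0 ∨ i = 1) (b : ℕ) (c : Fin b → ℤ) :
    pderiv i (∏ j, lin19 ℂ (c j)) = 0 := by
  refine Finset.prod_induction _ (fun q => pderiv i q = 0) ?_ ?_ ?_
  · intro a b ha hb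
    simp [ha, hb]
  · simp
  · intro j _
    rcases hi with rfl | rfl <;> simp [lin19, pderiv_X]

lemma F19_sqf (b : ℕ) : Squarefree (F19 ℂ b) := by
  rw [squarefree_iff_irreducible_sq_not_dvd_of_ne_zero]
  swap
  · intro h
    have := F19_eval_one b
    rw [h] at this
    simp at this
  intro p hpi ⟨r, hr⟩
  have hp := hpi.prime
  have hd : ∀ i, p ∣ pderiv i (F19 ℂ b) := by
    intro i
    rw [hr]
    simp only [Derivation.leibniz, smul_eq_mul]
    exact ⟨p * pderiv i r + 2 * r * pderiv i p, by ring⟩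
  have hA0 := pderiv_prod19 0 (Or.inl rfl) b (fun i => (i : ℕ))
  have hA1 := pderiv_prod19 1 (Or.inr rfl) b (fun i => (i : ℕ))
  have hB0 := pderiv_prod19 0 (Or.inl rfl) b (fun i => (-((i : ℕ) + 1 : ℤ)))
  have hB1 := pderiv_prod19 1 (Or.inr rfl) b (fun i => (-((i : ℕ) + 1 : ℤ)))
  have c2 : (C 2 : MvPolynomial (Fin 4) ℂ) = 2 := map_ofNat C 2
  have e0 : pderiv 0 (F19 ℂ b) = C 2 * (X 0 * AA19 ℂ b ^ 2) := by
    simp only [F19, AA19, BB19, map_add, Derivation.leibniz, Derivation.leibniz_pow, hA0, hB0]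
    simp [pderiv_X]
    rw [c2]
    ring
  have e1 : pderiv 1 (F19 ℂ b) = C 2 * (X 1 * BB19 ℂ b ^ 2) := by
    simp only [F19, AA19, BB19, map_add, Derivation.leibniz, Derivation.leibniz_pow, hA1, hB1]
    simp [pderiv_X]
    rw [c2]
    ring
  have u2 : IsUnit (C 2 : MvPolynomial (Fin 4) ℂ) := (IsUnit.mk0 (2:ℂ) two_ne_zero).map C
  have d0 := hd 0
  have d1 := hd 1
  rw [e0, u2.dvd_mul_left, hp.dvd_mul] at d0
  rw [e1, u2.dvd_mul_left, hp.dvd_mul] at d1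
  rcases d0 with d0 | d0
  · rcases d1 with d1 | d1
    · exact not_dvd_X19 hp d0 _ ![0,1,0,0] rfl (by simp) d1
    · exact not_dvd_X19 hp d0 _ ![0,1,1,0] rfl (by simp [BB19, lin19, map_prod]) d1
  · rcases d1 with d1 | d1
    · exact not_dvd_X19 hp d1 _ ![1,0,1,0] rfl (by simp [AA19, lin19, map_prod]) d0
    · have d0 := hp.dvd_of_dvd_pow d0
      have d1 := hp.dvd_of_dvd_pow d1
      rw [AA19, hp.dvd_finsetProd_iff] at d0
      rw [BB19, hp.dvd_finsetProd_iff] at d1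
      obtain ⟨i, -, hi⟩ := d0
      obtain ⟨j, -, hj⟩ := d1
      have h3 : p ∣ C ((i : ℂ) + j + 1) * X 3 := by
        have := dvd_sub hj hi
        convert this using 1
        simp [lin19]
        ring
      have u : IsUnit (C ((i : ℂ) + j + 1) : MvPolynomial (Fin 4) ℂ) := by
        refine (IsUnit.mk0 _ ?_).map C
        exact_mod_cast Nat.succ_ne_zero (i + j : ℕ)
      rw [u.dvd_mul_left] at h3
      exact not_dvd_X19 hp h3 _ ![0,0,1,0] rfl (by simp [lin19]) hi

lemma eq_mk19 (p : Projectivization ℝ (Fin 2 → ℝ)) (v : Fin 2 → ℝ) (hv : v ≠ 0) :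
    p = Projectivization.mk ℝ v hv ↔ p.rep 0 * v 1 = p.rep 1 * v 0 := by
  conv_lhs => rw [← p.mk_rep]
  rw [Projectivization.mk_eq_mk_iff']
  have hr := p.rep_nonzero
  constructor
  · rintro ⟨a, ha⟩
    rw [← ha]
    simp
    ring
  · intro h
    by_cases h0 : v 0 = 0
    · have h1 : v 1 ≠ 0 := fun h1 => hv (by ext i; fin_cases i <;> simp [h0, h1])
      refine ⟨p.rep 1 / v 1, ?_⟩
      have : p.rep 0 = 0 := by simpa [h0, h1] using h
      ext i; fin_cases i <;> simp [h0, h1, this]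
    · refine ⟨p.rep 0 / v 0, ?_⟩
      ext i; fin_cases i
      · simp [h0]
      · simp; field_simp; linarith

lemma ne19 (c : ℝ) : (![c, 1] : Fin 2 → ℝ) ≠ 0 := fun h => by simpa using congrFun h 1

lemma ne19' : (![1, 0] : Fin 2 → ℝ) ≠ 0 := fun h => by simpa using congrFun h 0

noncomputable def pts19 (b : ℕ) :
    Fin b ⊕ Fin b → Projectivization ℝ (Fin 2 → ℝ) × Projectivization ℝ (Fin 2 → ℝ)
  | .inl i => (.mk ℝ ![1,0] ne19', .mk ℝ ![(i : ℝ), 1] (ne19 _))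
  | .inr i => (.mk ℝ ![0,1] (ne19 _), .mk ℝ ![-((i : ℝ)+1), 1] (ne19 _))

lemma mk_inj19 {c d : ℝ}
    (h : Projectivization.mk ℝ ![c, 1] (ne19 c) = Projectivization.mk ℝ ![d, 1] (ne19 d)) :
    c = d := by
  rw [Projectivization.mk_eq_mk_iff'] at h
  obtain ⟨a, ha⟩ := h
  have h0 := congrFun ha 0
  have h1 := congrFun ha 1
  simp at h0 h1
  simp [← h0, h1]

lemma mk_ne19 {c : ℝ}
    (h : Projectivization.mk ℝ ![1, 0] ne19' = Projectivization.mk ℝ ![c, 1] (ne19 c)) :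
    False := by
  rw [Projectivization.mk_eq_mk_iff'] at h
  obtain ⟨a, ha⟩ := h
  have h0 := congrFun ha 0
  have h1 := congrFun ha 1
  simp at h0 h1
  simp [h1] at h0

lemma pts19_inj (b : ℕ) : Function.Injective (pts19 b) := by
  rintro (i | i) (j | j) h
  · have := mk_inj19 (Prod.ext_iff.mp h).2
    simp only [Nat.cast_inj] at this
    rw [Fin.ext this]
  · exact (mk_ne19 (Prod.ext_iff.mp h).1).elim
  · exact (mk_ne19 (Prod.ext_iff.mp h).1.symm).elim
  · have := mk_inj19 (Prod.ext_iff.mp h).2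
    simp only [neg_inj, add_left_inj, Nat.cast_inj] at this
    rw [Fin.ext this]

lemma RZ2_F19 (b : ℕ) : RZ2 (F19 ℝ b) = Set.range (pts19 b) := by
  ext ⟨p, q⟩
  have hp : ¬ (p.rep 0 = 0 ∧ p.rep 1 = 0) := fun h =>
    p.rep_nonzero (by ext i; fin_cases i <;> simp [h.1, h.2])
  have hq : ¬ (q.rep 0 = 0 ∧ q.rep 1 = 0) := fun h =>
    q.rep_nonzero (by ext i; fin_cases i <;> simp [h.1, h.2])
  have key : (p, q) ∈ RZ2 (F19 ℝ b) ↔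
      (p.rep 0 = 0 ∨ ∃ i : Fin b, q.rep 0 - i * q.rep 1 = 0) ∧
      (p.rep 1 = 0 ∨ ∃ i : Fin b, q.rep 0 - (-(i + 1)) * q.rep 1 = 0) := by
    have e : ∀ x y : ℝ, x ^ 2 + y ^ 2 = 0 ↔ x = 0 ∧ y = 0 := by
      intro x y
      constructor
      · intro h
        constructor <;> nlinarith [sq_nonneg x, sq_nonneg y]
      · rintro ⟨rfl, rfl⟩; simp
    simp only [RZ2, Set.mem_ofPred_eq, F19, AA19, BB19, lin19, map_add, map_mul, map_pow, map_prod,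
      ← mul_pow, e, mul_eq_zero, Finset.prod_eq_zero_iff]
    simp
  have r : (p, q) ∈ Set.range (pts19 b) ↔
      (∃ i : Fin b, p.rep 1 = 0 ∧ q.rep 0 = q.rep 1 * i) ∨
      (∃ i : Fin b, p.rep 0 = 0 ∧ q.rep 0 = q.rep 1 * (-(i + 1))) := by
    simp only [Set.mem_range, Sum.exists, pts19, eq_comm (b := (p, q)), Prod.mk.injEq, eq_mk19]
    simp [eq_comm]
  rw [key, r]
  constructor
  · rintro ⟨h | ⟨i, hi⟩, h' | ⟨j, hj⟩⟩
    · exact (hp ⟨h, h'⟩).elim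
    · exact Or.inr ⟨j, h, by linarith⟩
    · exact Or.inl ⟨i, h', by linarith⟩
    · exfalso
      have h1 : ((i : ℝ) + j + 1) * q.rep 1 = 0 := by linarith
      have h2 : ((i : ℝ) + j + 1) ≠ 0 := by positivity
      have h3 := (mul_eq_zero.mp h1).resolve_left h2
      exact hq ⟨by simpa [h3] using hi, h3⟩
  · rintro (⟨i, h, hi⟩ | ⟨i, h, hi⟩)
    · exact ⟨Or.inr ⟨i, by linarith⟩, Or.inl h⟩
    · exact ⟨Or.inl h, Or.inr ⟨i, by linarith⟩⟩

theorem stmt_19 (b : ℕ) :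
    ∃ F : MvPolynomial (Fin 4) ℝ, F ≠ 0 ∧
      Bihomogeneous F 2 (2 * b) ∧
      Squarefree (MvPolynomial.map (algebraMap ℝ ℂ) F) ∧
      (RZ2 F).Finite ∧ (RZ2 F).ncard = 2 * b := by
  refine ⟨F19 ℝ b, F19_ne b, F19_bihom b, ?_, ?_, ?_⟩
  · rw [map_F19]
    exact F19_sqf b
  · rw [RZ2_F19]
    exact Set.finite_range _
  · rw [RZ2_F19, ← Set.image_univ, Set.ncard_image_of_injective _ (pts19_inj b), Set.ncard_univ]
    simp
    ring
end
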